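/- arXiv:1403.1215 — 3 statements merged into one kernel-verified Lean document; each statement's English description precedes it below -/
import Mathlib

section
/- For any H₁, H₂ ∈ (0,1) there exists θ ∈ ℝ with θ ≠ 0 such that the kernel (u,v) ↦ R_θ(u − v) is positive semidefinite on ℝ² × ℝ²: for every n ∈ ℕ, every family of points v¹, …, vⁿ ∈ ℝ², and every c₁, …, cₙ ∈ ℝ, one has Σ_{i=1}^{n} Σ_{j=1}^{n} c_i·c_j·R_θ(vⁱ − vʲ) ≥ 0. -/
open Real

/-- `F_H(v) = 2 cosh(Hv) - |2 sinh(v/2)|^{2H}`. -/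
noncomputable def Ffun (H v : ℝ) : ℝ :=
  2 * Real.cosh (H * v) - |2 * Real.sinh (v / 2)| ^ (2 * H)

/-- `R_θ(v₁,v₂) = (1/4) F_{H₁}(v₁) F_{H₂}(v₂)
  (1 + θ e^{−H₁|v₁| − H₂|v₂|} sinh(H₁v₁) sinh(H₂v₂))`. -/
noncomputable def Rtheta (H₁ H₂ θ v₁ v₂ : ℝ) : ℝ :=
  (1 / 4) * Ffun H₁ v₁ * Ffun H₂ v₂
    * (1 + θ * Real.exp (-(H₁ * |v₁|) - H₂ * |v₂|)
        * Real.sinh (H₁ * v₁) * Real.sinh (H₂ * v₂))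

/-- The coefficients of the power series of `(1 - x) ^ α`. -/
noncomputable def binomCoeff (α : ℝ) : ℕ → ℝ
  | 0 => 1
  | k + 1 => binomCoeff α k * ((k - α) / (k + 1))

lemma binomCoeff_zero (α : ℝ) : binomCoeff α 0 = 1 := rfl

lemma binomCoeff_succ (α : ℝ) (k : ℕ) :
    binomCoeff α (k + 1) = binomCoeff α k * ((k - α) / (k + 1)) := rfl

lemma binomCoeff_one (α : ℝ) : binomCoeff α 1 = -α := by
  simp [binomCoeff]

lemma binomCoeff_eq_choose (α : ℝ) (k : ℕ) :
    binomCoeff α k = (-1) ^ k * Ring.choose α k := by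
  induction k with
  | zero => simp [binomCoeff]
  | succ k ih =>
    have h : Ring.choose α (k + 1) * (k + 1) = Ring.choose α k * (α - k) := by
      simp only [Ring.choose_eq_smul, descPochhammer_succ_right, Polynomial.smeval_mul,
        Polynomial.smeval_sub, Polynomial.smeval_X, Polynomial.smeval_natCast,
        Nat.factorial_succ, smul_eq_mul]
      have : (k.factorial : ℝ) ≠ 0 := by positivity
      push_cast
      field_simp
      simp
    have h' : Ring.choose α (k + 1) = Ring.choose α k * (α - k) / (k + 1) := by
      rw [eq_div_iff (by positivity), h]
    rw [binomCoeff, ih, h', pow_succ]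
    ring

lemma hasSum_binomCoeff (α : ℝ) {x : ℝ} (hx : |x| < 1) :
    HasSum (fun k ↦ binomCoeff α k * x ^ k) ((1 - x) ^ α) := by
  have h := (one_add_rpow_hasFPowerSeriesOnBall_zero (a := α)).hasSum (y := -x)
    (by simpa [Metric.mem_eball, edist_dist, Real.dist_eq] using hx)
  simp only [binomialSeries_apply, zero_add] at h
  rw [← sub_eq_add_neg] at h
  refine h.congr_fun fun k ↦ ?_
  rw [binomCoeff_eq_choose, List.ofFn_const, List.prod_replicate, neg_pow x, smul_eq_mul]
  ring

lemma sum_binomCoeff {α : ℝ} (hα : α ≠ 0) (N : ℕ) :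
    ∑ k ∈ Finset.range N, binomCoeff α k = -(N / α) * binomCoeff α N := by
  induction N with
  | zero => simp
  | succ N ih =>
    rw [Finset.sum_range_succ, ih, binomCoeff]
    have : (N : ℝ) + 1 ≠ 0 := by positivity
    push_cast
    field_simp
    ring

lemma sum_mul_binomCoeff {α : ℝ} (hα : α ≠ 1) (N : ℕ) :
    ∑ k ∈ Finset.range N, k * binomCoeff α k = N * (N - 1) / (1 - α) * binomCoeff α N := by
  induction N with
  | zero => simp
  | succ N ih =>
    rw [Finset.sum_range_succ, ih, binomCoeff]
    have : (N : ℝ) + 1 ≠ 0 := by positivity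
    have : 1 - α ≠ 0 := sub_ne_zero.2 hα.symm
    push_cast
    field_simp
    ring

lemma binomCoeff_succ_nonpos {α : ℝ} (h0 : 0 ≤ α) (h1 : α ≤ 1) (k : ℕ) :
    binomCoeff α (k + 1) ≤ 0 := by
  induction k with
  | zero => simp [binomCoeff, h0]
  | succ k ih =>
    rw [binomCoeff]
    refine mul_nonpos_of_nonpos_of_nonneg ih (div_nonneg ?_ (by positivity))
    push_cast
    linarith [Nat.cast_nonneg (α := ℝ) k]

lemma binomCoeff_add_two_pos {α : ℝ} (h1 : 1 < α) (h2 : α < 2) (k : ℕ) :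
    0 < binomCoeff α (k + 2) := by
  induction k with
  | zero =>
    simp only [binomCoeff]
    norm_num
    nlinarith
  | succ k ih =>
    rw [binomCoeff]
    refine mul_pos ih (div_pos ?_ (by positivity))
    push_cast
    linarith [Nat.cast_nonneg (α := ℝ) k]

lemma summable_mul_binomCoeff {α : ℝ} (h1 : 1 < α) (h2 : α < 2) :
    Summable fun k : ℕ ↦ k * binomCoeff α k := by
  rw [← summable_nat_add_iff 2]
  refine summable_of_sum_range_le (c := α)
    (fun k ↦ mul_nonneg (by positivity) (binomCoeff_add_two_pos h1 h2 k).le) fun N ↦ ?_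
  have h := sum_mul_binomCoeff h1.ne' (N + 2)
  rw [Finset.sum_range_succ', Finset.sum_range_succ'] at h
  have h3 : (((N + 2 : ℕ) : ℝ) * ((N + 2 : ℕ) - 1) / (1 - α)) * binomCoeff α (N + 2) ≤ 0 := by
    refine mul_nonpos_of_nonpos_of_nonneg (div_nonpos_of_nonneg_of_nonpos ?_ (by linarith))
      (binomCoeff_add_two_pos h1 h2 N).le
    push_cast
    have := Nat.cast_nonneg (α := ℝ) N
    nlinarith
  rw [← h] at h3
  simp only [Nat.cast_zero, zero_mul, zero_add, Nat.cast_one, binomCoeff_one, one_mul,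
    add_assoc, one_add_one_eq_two] at h3
  linarith

lemma tsum_mul_binomCoeff_nonpos {α : ℝ} (h1 : 1 < α) (h2 : α < 2) :
    ∑' k : ℕ, k * binomCoeff α k ≤ 0 := by
  refine le_of_tendsto ((summable_mul_binomCoeff h1 h2).hasSum.tendsto_sum_nat) ?_
  filter_upwards [Filter.eventually_ge_atTop 2] with N hN
  obtain ⟨M, rfl⟩ := Nat.exists_eq_add_of_le' hN
  rw [sum_mul_binomCoeff h1.ne']
  refine mul_nonpos_of_nonpos_of_nonneg (div_nonpos_of_nonneg_of_nonpos ?_ (by linarith))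
    (binomCoeff_add_two_pos h1 h2 M).le
  push_cast
  have := Nat.cast_nonneg (α := ℝ) M
  nlinarith

lemma summable_binomCoeff {α : ℝ} (h0 : 0 < α) (h2 : α < 2) : Summable (binomCoeff α) := by
  rcases le_or_gt α 1 with h1 | h1
  · rw [← summable_nat_add_iff 1, ← summable_neg_iff]
    refine summable_of_sum_range_le (c := 1)
      (fun k ↦ neg_nonneg.2 (binomCoeff_succ_nonpos h0.le h1 k)) fun N ↦ ?_
    have h := sum_binomCoeff h0.ne' (N + 1)
    rw [Finset.sum_range_succ'] at h
    have h3 : 0 ≤ -(((N + 1 : ℕ) : ℝ) / α) * binomCoeff α (N + 1) :=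
      mul_nonneg_of_nonpos_of_nonpos (neg_nonpos.2 (by positivity))
        (binomCoeff_succ_nonpos h0.le h1 N)
    rw [Finset.sum_neg_distrib]
    rw [← h, binomCoeff_zero] at h3
    linarith
  · rw [← summable_nat_add_iff 1]
    refine Summable.of_norm_bounded ((summable_nat_add_iff 1).2
      (summable_mul_binomCoeff h1 h2)).norm fun k ↦ ?_
    rw [norm_mul]
    refine le_mul_of_one_le_left (norm_nonneg _) ?_
    rw [Real.norm_of_nonneg (by positivity)]
    simp

lemma tsum_binomCoeff {α : ℝ} (h1 : 1 < α) (h2 : α < 2) : ∑' k, binomCoeff α k = 0 := by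
  have h := (summable_mul_binomCoeff h1 h2).tendsto_atTop_zero.const_mul (-α⁻¹)
  refine tendsto_nhds_unique
    (summable_binomCoeff (by linarith) h2).hasSum.tendsto_sum_nat ?_
  rw [mul_zero] at h
  refine h.congr fun N ↦ ?_
  rw [sum_binomCoeff (by linarith)]
  ring

lemma le_cube_mul_binomCoeff {α : ℝ} (h1 : 1 < α) (h2 : α < 2) (k : ℕ) :
    α * (α - 1) * (2 - α) ≤ (k + 3) * (k + 2) * (k + 1) * binomCoeff α (k + 3) := by
  induction k with
  | zero =>
    simp only [binomCoeff]
    norm_num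
    apply le_of_eq
    ring
  | succ k ih =>
    refine ih.trans ?_
    have h := (binomCoeff_add_two_pos h1 h2 (k + 1)).le
    have : (k : ℝ) + 4 ≠ 0 := by positivity
    have e : (((k + 1 : ℕ) : ℝ) + 3) * ((k + 1 : ℕ) + 2) * ((k + 1 : ℕ) + 1) *
        binomCoeff α (k + 1 + 3) = (k + 3) * (k + 2) * (k + 3 - α) * binomCoeff α (k + 3) := by
      rw [show k + 1 + 3 = k + 3 + 1 by ring, binomCoeff_succ]
      push_cast
      rw [show (k : ℝ) + 3 + 1 = k + 4 by ring, show (k : ℝ) + 1 + 3 = k + 4 by ring]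
      field_simp
      ring
    rw [e]
    gcongr
    linarith

open MeasureTheory Filter Topology FourierTransform ComplexOrder in
/-- A continuous integrable function with nonnegative Fourier transform is positive definite. -/
lemma posSemidef_of_fourier_nonneg {K : ℝ → ℂ} (hc : Continuous K) (hi : Integrable K)
    (hsymm : ∀ v, star (K v) = K (-v)) {k : ℝ → ℝ} (hk : ∀ w, 𝓕 K w = k w)
    (hk0 : ∀ w, 0 ≤ k w) {n : ℕ} (x : Fin n → ℝ) :
    (Matrix.of fun i j ↦ K (x i - x j)).PosSemidef := by
  have hlim (v : ℝ) : Tendsto (fun c : ℝ ↦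
      ∫ w : ℝ, Complex.exp (-c⁻¹ * ‖w‖ ^ 2 + 2 * π * Complex.I * inner ℝ v w) * k w)
      atTop (𝓝 (K v)) := by
    refine (Real.tendsto_integral_gaussian_smul' hi (v := v) hc.continuousAt).congr' ?_
    filter_upwards [Ioi_mem_atTop 0] with c (hc : 0 < c)
    have J : Integrable (fun w : ℝ ↦
        Complex.exp (-c⁻¹ * ‖w‖ ^ 2 + 2 * π * Complex.I * inner ℝ v w)) :=
      GaussianFourier.integrable_cexp_neg_mul_sq_norm_add (by simpa) _ _
    have h := VectorFourier.integral_fourierIntegral_smul_eq_flip (L := innerₗ ℝ)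
      Real.continuous_fourierChar continuous_inner J hi
    have h' : ∫ w, 𝓕 (fun w : ℝ ↦
        Complex.exp (-c⁻¹ * ‖w‖ ^ 2 + 2 * π * Complex.I * inner ℝ v w)) w • K w =
        ∫ w : ℝ, Complex.exp (-c⁻¹ * ‖w‖ ^ 2 + 2 * π * Complex.I * inner ℝ v w) • 𝓕 K w := by
      simpa using! h
    simp only [hk, smul_eq_mul] at h'
    rw [← h']
    congr with w
    rw [fourier_gaussian_innerProductSpace' (by simpa), smul_eq_mul]
    congr 3
    · simp
    · simp; ring
  have hbound (w : ℝ) : ‖(k w : ℂ)‖ ≤ ∫ v, ‖K v‖ := by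
    rw [← hk]
    exact VectorFourier.norm_fourierIntegral_le_integral_norm _ _ _ _ _
  have hkc : Continuous fun w ↦ (k w : ℂ) := by
    have := VectorFourier.fourierIntegral_continuous (L := innerₗ ℝ)
      Real.continuous_fourierChar continuous_inner hi
    refine this.congr fun w ↦ ?_
    rw [← hk]
    rfl
  refine .of_dotProduct_mulVec_nonneg ?_ fun y ↦ ?_
  · ext i j
    simp [Matrix.conjTranspose_apply, hsymm]
  · have hsum : star y ⬝ᵥ (Matrix.of fun i j ↦ K (x i - x j)).mulVec y =
        ∑ i, ∑ j, star (y i) * y j * K (x i - x j) := by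
      simp only [dotProduct, Matrix.mulVec, Matrix.of_apply, Pi.star_apply, Finset.mul_sum]
      refine Finset.sum_congr rfl fun i _ ↦ Finset.sum_congr rfl fun j _ ↦ by ring
    rw [hsum]
    refine ge_of_tendsto (tendsto_finsetSum _ fun i _ ↦ tendsto_finsetSum _ fun j _ ↦
      (hlim (x i - x j)).const_mul (star (y i) * y j)) ?_
    filter_upwards [Ioi_mem_atTop 0] with c (hc : 0 < c)
    have J (v : ℝ) : Integrable (fun w : ℝ ↦
        Complex.exp (-c⁻¹ * ‖w‖ ^ 2 + 2 * π * Complex.I * inner ℝ v w) * k w) := by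
      refine Integrable.mul_bdd (c := ∫ v, ‖K v‖)
        (GaussianFourier.integrable_cexp_neg_mul_sq_norm_add (by simpa) _ _)
        hkc.aestronglyMeasurable (Eventually.of_forall hbound)
    have e : ∑ i, ∑ j, star (y i) * y j * ∫ w : ℝ, Complex.exp (-c⁻¹ * ‖w‖ ^ 2 +
          2 * π * Complex.I * inner ℝ (x i - x j) w) * k w =
        ∫ w : ℝ, ((Real.exp (-c⁻¹ * ‖w‖ ^ 2) * k w *
          Complex.normSq (∑ i, y i * Complex.exp (-(2 * π * Complex.I * (x i * w)))) : ℝ) : ℂ) := by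
      simp_rw [← integral_const_mul]
      have (i : Fin n) := integral_finsetSum (μ := volume) Finset.univ
        fun j _ ↦ (J (x i - x j)).const_mul (star (y i) * y j)
      simp_rw [← this]
      rw [← integral_finsetSum Finset.univ fun i _ ↦ integrable_finsetSum _
        fun j _ ↦ (J (x i - x j)).const_mul (star (y i) * y j)]
      congr with w
      push_cast
      rw [Complex.normSq_eq_conj_mul_self, map_sum, Finset.sum_mul_sum, Finset.mul_sum]
      refine Finset.sum_congr rfl fun i _ ↦ ?_
      rw [Finset.mul_sum]
      refine Finset.sum_congr rfl fun j _ ↦ ?_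
      have : Complex.exp (-c⁻¹ * ‖w‖ ^ 2 + 2 * π * Complex.I * inner ℝ (x i - x j) w) =
          Complex.exp (-c⁻¹ * ‖w‖ ^ 2) * (Complex.exp (2 * π * Complex.I * (x i * w)) *
            Complex.exp (-(2 * π * Complex.I * (x j * w)))) := by
        rw [← Complex.exp_add, ← Complex.exp_add]
        congr 1
        simp
        ring
      push_cast at this
      rw [this, map_mul, ← Complex.exp_conj]
      simp [map_ofNat]
      ring
    rw [e, integral_complex_ofReal]
    refine Complex.zero_le_real.2 (integral_nonneg fun w ↦ ?_)
    exact mul_nonneg (mul_nonneg (Real.exp_pos _).le (hk0 w)) (Complex.normSq_nonneg _)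

/-- The exponential kernel `e^{-l|v|}` with an odd imaginary perturbation. -/
noncomputable def decayKernel (H ε l v : ℝ) : ℂ :=
  Real.exp (-(l * |v|)) *
    (1 + ε * (Real.exp (-(H * |v|)) * Real.sinh (H * v) : ℝ) * Complex.I)

lemma abs_exp_mul_sinh_le {H : ℝ} (hH : 0 ≤ H) (v : ℝ) :
    |Real.exp (-(H * |v|)) * Real.sinh (H * v)| ≤ 1 := by
  rw [abs_mul, abs_of_pos (Real.exp_pos _), Real.abs_sinh, abs_mul, abs_of_nonneg hH,
    Real.exp_neg, inv_mul_le_one₀ (Real.exp_pos _), Real.sinh_eq]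
  linarith [Real.exp_pos (H * |v|), Real.exp_pos (-(H * |v|))]

lemma norm_one_add_mul_I_le {H : ℝ} (hH : 0 ≤ H) (ε v : ℝ) :
    ‖(1 + ε * (Real.exp (-(H * |v|)) * Real.sinh (H * v) : ℝ) * Complex.I : ℂ)‖ ≤ 1 + |ε| := by
  refine (norm_add_le _ _).trans ?_
  rw [norm_one, norm_mul, norm_mul, Complex.norm_I, mul_one, Complex.norm_real, Complex.norm_real]
  have := abs_exp_mul_sinh_le hH v
  rw [Real.norm_eq_abs, Real.norm_eq_abs]
  nlinarith [abs_nonneg ε]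

lemma continuous_one_add_mul_I (H ε : ℝ) : Continuous fun v : ℝ ↦
    (1 + ε * (Real.exp (-(H * |v|)) * Real.sinh (H * v) : ℝ) * Complex.I : ℂ) := by
  fun_prop

lemma continuous_decayKernel (H ε l : ℝ) : Continuous (decayKernel H ε l) := by
  unfold decayKernel
  fun_prop

lemma norm_decayKernel_le {H : ℝ} (hH : 0 ≤ H) (ε l v : ℝ) :
    ‖decayKernel H ε l v‖ ≤ (1 + |ε|) * Real.exp (-(l * |v|)) := by
  rw [decayKernel, norm_mul, Complex.norm_real, Real.norm_of_nonneg (Real.exp_pos _).le, mul_comm]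
  gcongr
  exact norm_one_add_mul_I_le hH ε v

open MeasureTheory in
lemma integrable_exp_neg_mul_abs {l : ℝ} (hl : 0 < l) :
    Integrable fun v : ℝ ↦ Real.exp (-(l * |v|)) := by
  rw [← integrableOn_univ, ← Set.Iic_union_Ioi (a := (0 : ℝ))]
  refine IntegrableOn.union ?_ ?_
  · refine (integrableOn_exp_mul_Iic hl 0).congr_fun (fun v hv ↦ ?_) measurableSet_Iic
    simp [abs_of_nonpos (Set.mem_Iic.1 hv)]
  · refine (integrableOn_exp_mul_Ioi (neg_neg_of_pos hl) 0).congr_fun (fun v hv ↦ ?_)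
      measurableSet_Ioi
    simp [abs_of_pos (Set.mem_Ioi.1 hv)]

open MeasureTheory in
lemma integrable_decayKernel {H l : ℝ} (hH : 0 ≤ H) (hl : 0 < l) (ε : ℝ) :
    Integrable (decayKernel H ε l) :=
  ((integrable_exp_neg_mul_abs hl).const_mul (1 + |ε|)).mono'
    (continuous_decayKernel H ε l).aestronglyMeasurable
    (Filter.Eventually.of_forall (norm_decayKernel_le hH ε l))

/-- The Fourier transform of `decayKernel`, in angular frequency. -/
noncomputable def decaySpectrum (H ε l w : ℝ) : ℝ :=
  2 * l / (l ^ 2 + w ^ 2) + ε * (w * (1 / (l ^ 2 + w ^ 2) - 1 / ((l + 2 * H) ^ 2 + w ^ 2)))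

open MeasureTheory FourierTransform in
lemma fourier_decayKernel {H l : ℝ} (hH : 0 ≤ H) (hl : 0 < l) (ε w : ℝ) :
    𝓕 (decayKernel H ε l) w = decaySpectrum H ε l (2 * π * w) := by
  rw [Real.fourier_real_eq_integral_exp_smul]
  set ω : ℝ := 2 * π * w with hω
  have hpos : ∀ v ∈ Set.Ioi (0 : ℝ),
      Complex.exp (((-2 * π * v * w : ℝ) : ℂ) * Complex.I) • decayKernel H ε l v =
      (1 + ε * Complex.I / 2) * Complex.exp ((-l - ω * Complex.I) * v) -
        ε * Complex.I / 2 * Complex.exp ((-(l + 2 * H) - ω * Complex.I) * v) := by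
    intro v hv
    have e1 : Complex.exp ((-l - ω * Complex.I) * v) =
        Complex.exp (((-2 * π * v * w : ℝ) : ℂ) * Complex.I) * Complex.exp (-(l * v)) := by
      rw [← Complex.exp_add, hω]; congr 1; push_cast; ring
    have e2 : Complex.exp ((-(l + 2 * H) - ω * Complex.I) * v) =
        Complex.exp (((-2 * π * v * w : ℝ) : ℂ) * Complex.I) * Complex.exp (-(l * v)) *
          (Complex.exp (-(H * v)) * Complex.exp (-(H * v))) := by
      rw [← Complex.exp_add, ← Complex.exp_add, ← Complex.exp_add, hω]; congr 1; push_cast; ring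
    have e3 : Complex.exp (-(H * v)) * Complex.exp (H * v) = 1 := by
      rw [← Complex.exp_add]; simp
    rw [e1, e2, decayKernel, abs_of_pos (Set.mem_Ioi.1 hv), smul_eq_mul]
    push_cast
    rw [Complex.sinh]
    linear_combination (Complex.exp (((-2 * π * v * w) : ℂ) * Complex.I) *
      Complex.exp (-(l * v)) * ε * Complex.I / 2) * e3
  have hneg : ∀ v ∈ Set.Iic (0 : ℝ),
      Complex.exp (((-2 * π * v * w : ℝ) : ℂ) * Complex.I) • decayKernel H ε l v =
      (1 - ε * Complex.I / 2) * Complex.exp ((l - ω * Complex.I) * v) +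
        ε * Complex.I / 2 * Complex.exp ((l + 2 * H - ω * Complex.I) * v) := by
    intro v hv
    have e1 : Complex.exp ((l - ω * Complex.I) * v) =
        Complex.exp (((-2 * π * v * w : ℝ) : ℂ) * Complex.I) * Complex.exp (l * v) := by
      rw [← Complex.exp_add, hω]; congr 1; push_cast; ring
    have e2 : Complex.exp ((l + 2 * H - ω * Complex.I) * v) =
        Complex.exp (((-2 * π * v * w : ℝ) : ℂ) * Complex.I) * Complex.exp (l * v) *
          (Complex.exp (H * v) * Complex.exp (H * v)) := by
      rw [← Complex.exp_add, ← Complex.exp_add, ← Complex.exp_add, hω]; congr 1; push_cast; ring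
    have e3 : Complex.exp (-(H * v)) * Complex.exp (H * v) = 1 := by
      rw [← Complex.exp_add]; simp
    rw [e1, e2, decayKernel, abs_of_nonpos (Set.mem_Iic.1 hv), smul_eq_mul]
    push_cast
    rw [Complex.sinh]
    simp only [mul_neg, neg_neg]
    linear_combination (-(Complex.exp (((-2 * π * v * w) : ℂ) * Complex.I) *
      Complex.exp (l * v) * ε * Complex.I / 2)) * e3
  have hint : Integrable fun v : ℝ ↦
      Complex.exp (((-2 * π * v * w : ℝ) : ℂ) * Complex.I) • decayKernel H ε l v := by
    refine (integrable_decayKernel hH hl ε).bdd_mul (c := 1) (by fun_prop)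
      (Filter.Eventually.of_forall fun v ↦ ?_)
    rw [Complex.norm_exp_ofReal_mul_I]
  have h1 : (-l - ω * Complex.I : ℂ).re < 0 := by simpa
  have h2 : (-(l + 2 * H) - ω * Complex.I : ℂ).re < 0 := by simp; linarith
  have h3 : 0 < (l - ω * Complex.I : ℂ).re := by simpa
  have h4 : 0 < (l + 2 * H - ω * Complex.I : ℂ).re := by simp; linarith
  rw [← intervalIntegral.integral_Iic_add_Ioi (b := (0 : ℝ)) hint.integrableOn hint.integrableOn,
    setIntegral_congr_fun measurableSet_Iic hneg, setIntegral_congr_fun measurableSet_Ioi hpos,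
    integral_add ((integrableOn_exp_mul_complex_Iic h3 0).const_mul _)
      ((integrableOn_exp_mul_complex_Iic h4 0).const_mul _),
    integral_sub ((integrableOn_exp_mul_complex_Ioi h1 0).const_mul _)
      ((integrableOn_exp_mul_complex_Ioi h2 0).const_mul _)]
  simp only [integral_const_mul]
  rw [integral_exp_mul_complex_Iic h3, integral_exp_mul_complex_Iic h4,
    integral_exp_mul_complex_Ioi h1, integral_exp_mul_complex_Ioi h2]
  simp only [Complex.ofReal_zero, mul_zero, Complex.exp_zero]
  have key {m : ℝ} (hm : 0 < m) :
      1 / ((m : ℂ) - ω * Complex.I) = (m + ω * Complex.I) * (1 / (m ^ 2 + ω ^ 2)) ∧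
      1 / (-(m : ℂ) - ω * Complex.I) = -(m - ω * Complex.I) * (1 / (m ^ 2 + ω ^ 2)) := by
    have h : (m : ℂ) ^ 2 + ω ^ 2 ≠ 0 := by exact_mod_cast (by positivity : m ^ 2 + ω ^ 2 ≠ 0)
    have hm1 : (m : ℂ) - ω * Complex.I ≠ 0 := fun h ↦ by
      simpa [hm.ne'] using congrArg Complex.re h
    have hm2 : -(m : ℂ) - ω * Complex.I ≠ 0 := fun h ↦ by
      simpa [hm.ne'] using congrArg Complex.re h
    constructor
    · field_simp
      linear_combination (ω : ℂ) ^ 2 * Complex.I_sq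
    · field_simp
      linear_combination (ω : ℂ) ^ 2 * Complex.I_sq
  obtain ⟨k1, k2⟩ := key hl
  obtain ⟨k3, k4⟩ := key (show 0 < l + 2 * H by linarith)
  push_cast at k3 k4
  rw [decaySpectrum, neg_div, neg_div, k1, k2, k3, k4]
  push_cast
  linear_combination (-(ε * ω * (1 / ((l : ℂ) ^ 2 + ω ^ 2) -
    1 / (((l : ℂ) + 2 * H) ^ 2 + ω ^ 2)))) * Complex.I_sq

lemma Ffun_eq (H v : ℝ) : Ffun H v = Real.exp (-(H * |v|)) +
    Real.exp (H * |v|) * (1 - (1 - Real.exp (-|v|)) ^ (2 * H)) := by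
  have hx : 0 ≤ 1 - Real.exp (-|v|) := by simp
  have h1 : |2 * Real.sinh (v / 2)| = Real.exp (|v| / 2) * (1 - Real.exp (-|v|)) := by
    rw [abs_mul, Real.abs_sinh, abs_div, abs_two, Real.sinh_eq, mul_sub, ← Real.exp_add]
    ring_nf
  have h2 : Real.cosh (H * v) = Real.cosh (H * |v|) := by
    rcases abs_cases v with ⟨h, -⟩ | ⟨h, -⟩ <;> simp [h]
  rw [Ffun, h1, Real.mul_rpow (Real.exp_pos _).le hx, ← Real.exp_mul, h2, Real.cosh_eq,
    show |v| / 2 * (2 * H) = H * |v| by ring]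
  ring

lemma hasSum_Ffun (H : ℝ) {v : ℝ} (hv : v ≠ 0) :
    HasSum (fun k : ℕ ↦ -binomCoeff (2 * H) (k + 1) * Real.exp (-((k + 1 - H) * |v|)))
      (Ffun H v - Real.exp (-(H * |v|))) := by
  have hx : |Real.exp (-|v|)| < 1 := by
    rw [abs_of_pos (Real.exp_pos _), Real.exp_lt_one_iff]
    simpa using hv
  have h := ((hasSum_nat_add_iff' 1).2 (hasSum_binomCoeff (2 * H) hx)).mul_left
    (-Real.exp (H * |v|))
  rw [Finset.sum_range_one, binomCoeff_zero] at h
  convert! h using 1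
  · ext k
    rw [← Real.exp_nat_mul, show -((k + 1 - H) * |v|) = H * |v| + (k + 1 : ℕ) * -|v| by
      push_cast; ring, Real.exp_add]
    ring
  · rw [Ffun_eq]
    ring

/-- The kernel `F_H` with an odd imaginary perturbation. -/
noncomputable def perturbedKernel (H ε v : ℝ) : ℂ :=
  Ffun H v * (1 + ε * (Real.exp (-(H * |v|)) * Real.sinh (H * v) : ℝ) * Complex.I)

lemma continuous_Ffun {H : ℝ} (hH : 0 < H) : Continuous (Ffun H) := by
  unfold Ffun
  refine Continuous.sub (by fun_prop) (Continuous.rpow_const (by fun_prop) fun v ↦ ?_)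
  right; positivity

lemma continuous_perturbedKernel {H : ℝ} (hH : 0 < H) (ε : ℝ) :
    Continuous (perturbedKernel H ε) := by
  have := continuous_Ffun hH
  unfold perturbedKernel
  fun_prop

open MeasureTheory in
lemma integrable_Ffun {H : ℝ} (h0 : 0 < H) (h1 : H < 1) : Integrable (Ffun H) := by
  have hs : Summable fun k ↦ ‖-binomCoeff (2 * H) (k + 1)‖ :=
    ((summable_nat_add_iff 1).2 (summable_binomCoeff (by linarith) (by linarith))).neg.norm
  refine (((integrable_exp_neg_mul_abs h0).add ((integrable_exp_neg_mul_abs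
    (sub_pos.2 h1)).const_mul (∑' k, ‖-binomCoeff (2 * H) (k + 1)‖)))).mono'
    (continuous_Ffun h0).aestronglyMeasurable ?_
  filter_upwards [Measure.ae_ne volume 0] with v hv
  have h := hasSum_Ffun H hv
  have hb : ‖Ffun H v - Real.exp (-(H * |v|))‖ ≤
      (∑' k, ‖-binomCoeff (2 * H) (k + 1)‖) * Real.exp (-((1 - H) * |v|)) := by
    rw [← h.tsum_eq]
    refine tsum_of_norm_bounded (hs.hasSum.mul_right _) fun k ↦ ?_
    rw [norm_mul, Real.norm_of_nonneg (Real.exp_pos _).le]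
    gcongr
    linarith [Nat.cast_nonneg (α := ℝ) k]
  calc ‖Ffun H v‖ = ‖Real.exp (-(H * |v|)) + (Ffun H v - Real.exp (-(H * |v|)))‖ := by
        congr 1; ring
    _ ≤ _ := (norm_add_le _ _).trans
        (add_le_add (Real.norm_of_nonneg (Real.exp_pos _).le).le hb)

open MeasureTheory in
lemma integrable_perturbedKernel {H : ℝ} (h0 : 0 < H) (h1 : H < 1) (ε : ℝ) :
    Integrable (perturbedKernel H ε) :=
  (integrable_Ffun h0 h1).ofReal.mul_bdd (c := 1 + |ε|)
    (continuous_one_add_mul_I H ε).aestronglyMeasurable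
    (Filter.Eventually.of_forall (norm_one_add_mul_I_le h0.le ε))

open MeasureTheory FourierTransform in
lemma fourier_perturbedKernel {H : ℝ} (h0 : 0 < H) (h1 : H < 1) (ε w : ℝ) :
    𝓕 (perturbedKernel H ε) w = (decaySpectrum H ε H (2 * π * w) +
      ∑' k : ℕ, -binomCoeff (2 * H) (k + 1) * decaySpectrum H ε (k + 1 - H) (2 * π * w) : ℝ) := by
  have hpos (k : ℕ) : 1 - H ≤ k + 1 - H := by linarith [Nat.cast_nonneg (α := ℝ) k]
  have hs : Summable fun k ↦ ‖-binomCoeff (2 * H) (k + 1)‖ :=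
    ((summable_nat_add_iff 1).2 (summable_binomCoeff (by linarith) (by linarith))).neg.norm
  have hchar {f : ℝ → ℂ} (hf : Integrable f) : Integrable fun v : ℝ ↦
      Complex.exp (((-2 * π * v * w : ℝ) : ℂ) * Complex.I) • f v := by
    refine hf.bdd_mul (c := 1) (by fun_prop) (Filter.Eventually.of_forall fun v ↦ ?_)
    rw [Complex.norm_exp_ofReal_mul_I]
  have hdec (k : ℕ) : Integrable (decayKernel H ε (k + 1 - H)) :=
    integrable_decayKernel h0.le (by linarith [hpos k]) ε
  have hsum : HasSum (fun k : ℕ ↦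
      (-binomCoeff (2 * H) (k + 1) * decaySpectrum H ε (k + 1 - H) (2 * π * w) : ℂ))
      (∫ v : ℝ, ∑' k : ℕ, ((-binomCoeff (2 * H) (k + 1) : ℝ) : ℂ) *
        Complex.exp (((-2 * π * v * w : ℝ) : ℂ) * Complex.I) • decayKernel H ε (k + 1 - H) v) := by
    refine (hasSum_integral_of_summable_integral_norm
      (fun k ↦ (hchar (hdec k)).const_mul _) ?_).congr_fun fun k ↦ ?_
    · refine Summable.of_nonneg_of_le (fun k ↦ integral_nonneg fun v ↦ norm_nonneg _)
        (fun k ↦ ?_) (hs.mul_right (∫ v : ℝ, (1 + |ε|) * Real.exp (-((1 - H) * |v|))))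
      rw [← integral_const_mul]
      refine integral_mono ((hchar (hdec k)).const_mul _).norm
        (((integrable_exp_neg_mul_abs (sub_pos.2 h1)).const_mul _).const_mul _) fun v ↦ ?_
      dsimp only
      rw [norm_mul, norm_smul, Complex.norm_exp_ofReal_mul_I, Complex.norm_real, one_mul]
      refine mul_le_mul_of_nonneg_left ((norm_decayKernel_le h0.le ε _ v).trans ?_) (norm_nonneg _)
      gcongr
      linarith [hpos k]
    · rw [integral_const_mul, ← Real.fourier_real_eq_integral_exp_smul,
        fourier_decayKernel h0.le (by linarith [hpos k])]
      push_cast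
      rfl
  have hint : ∫ v : ℝ, ∑' k : ℕ, ((-binomCoeff (2 * H) (k + 1) : ℝ) : ℂ) *
        Complex.exp (((-2 * π * v * w : ℝ) : ℂ) * Complex.I) • decayKernel H ε (k + 1 - H) v =
      𝓕 (perturbedKernel H ε) w - 𝓕 (decayKernel H ε H) w := by
    rw [Real.fourier_real_eq_integral_exp_smul, Real.fourier_real_eq_integral_exp_smul,
      ← integral_sub (hchar (integrable_perturbedKernel h0 h1 ε))
        (hchar (integrable_decayKernel h0.le h0 ε))]
    refine integral_congr_ae ?_
    filter_upwards [Measure.ae_ne volume 0] with v hv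
    have h := (Complex.hasSum_ofReal.2 (hasSum_Ffun H hv)).mul_left
      (Complex.exp (((-2 * π * v * w : ℝ) : ℂ) * Complex.I) *
        (1 + ε * (Real.exp (-(H * |v|)) * Real.sinh (H * v) : ℝ) * Complex.I))
    rw [← smul_sub, smul_eq_mul]
    convert! h.tsum_eq using 1
    · refine tsum_congr fun k ↦ ?_
      rw [decayKernel, Complex.ofReal_mul (-binomCoeff (2 * H) (k + 1)), smul_eq_mul]
      ring
    · rw [decayKernel, perturbedKernel, Complex.ofReal_sub]
      ring
  rw [hint] at hsum
  have := hsum.tsum_eq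
  rw [fourier_decayKernel h0.le h0] at this
  push_cast
  rw [this]
  ring

lemma abs_mul_one_add_abs_le {m l : ℝ} (hm : 0 < m) (hm1 : m ≤ 1) (hl : m ≤ l) (w : ℝ) :
    |w| * (1 + |w|) ≤ 2 / m ^ 2 * (l ^ 2 + w ^ 2) := by
  have h1 : m ^ 2 ≤ 1 := pow_le_one₀ hm.le hm1
  have h2 : m ^ 2 ≤ l ^ 2 := by gcongr
  have h3 := sq_abs w
  rw [div_mul_eq_mul_div, le_div_iff₀ (by positivity)]
  have h4 : |w| * (1 + |w|) ≤ 2 + 2 * w ^ 2 := by nlinarith [sq_nonneg (|w| - 1), abs_nonneg w]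
  calc |w| * (1 + |w|) * m ^ 2 ≤ (2 + 2 * w ^ 2) * m ^ 2 := by gcongr
    _ ≤ _ := by nlinarith [sq_nonneg w]

lemma abs_odd_part_le {H m l : ℝ} (h0 : 0 < H) (h1 : H < 1) (hm : 0 < m) (hm1 : m ≤ 1)
    (hl : m ≤ l) (w : ℝ) :
    |w * (1 / (l ^ 2 + w ^ 2) - 1 / ((l + 2 * H) ^ 2 + w ^ 2))| ≤
      8 / m ^ 2 / ((H ^ 2 + w ^ 2) * (1 + |w|)) * (l + 1) := by
  have hl0 : 0 < l := hm.trans_le hl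
  have e : w * (1 / (l ^ 2 + w ^ 2) - 1 / ((l + 2 * H) ^ 2 + w ^ 2)) =
      w * (4 * (H * (l + H))) / ((l ^ 2 + w ^ 2) * ((l + 2 * H) ^ 2 + w ^ 2)) := by
    field_simp
    ring
  have hA : H * (l + H) ≤ l + 1 := by nlinarith
  have hB : H ^ 2 + w ^ 2 ≤ (l + 2 * H) ^ 2 + w ^ 2 := by nlinarith
  have hC := abs_mul_one_add_abs_le hm hm1 hl w
  rw [e, abs_div, abs_mul, abs_of_pos (by positivity : 0 < 4 * (H * (l + H))),
    abs_of_pos (by positivity : 0 < (l ^ 2 + w ^ 2) * ((l + 2 * H) ^ 2 + w ^ 2)),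
    div_mul_eq_mul_div, div_le_div_iff₀ (by positivity) (by positivity)]
  calc |w| * (4 * (H * (l + H))) * ((H ^ 2 + w ^ 2) * (1 + |w|))
      = (|w| * (1 + |w|)) * (4 * (H * (l + H))) * (H ^ 2 + w ^ 2) := by ring
    _ ≤ (2 / m ^ 2 * (l ^ 2 + w ^ 2)) * (4 * (l + 1)) * ((l + 2 * H) ^ 2 + w ^ 2) := by gcongr
    _ = _ := by ring

lemma decaySpectrum_one_nonneg {H l : ℝ} (h0 : 0 < H) (hl : H ≤ l) (w : ℝ) :
    0 ≤ decaySpectrum H 1 l w := by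
  have hl0 : 0 < l := h0.trans_le hl
  have e : decaySpectrum H 1 l w = (2 * l * ((l + 2 * H) ^ 2 + w ^ 2) + 4 * H * (l + H) * w) /
      ((l ^ 2 + w ^ 2) * ((l + 2 * H) ^ 2 + w ^ 2)) := by
    rw [decaySpectrum]
    field_simp
    ring
  rw [e]
  refine div_nonneg ?_ (by positivity)
  have h2 : 2 * H * (l + 2 * H) * w ≥ -(H * ((l + 2 * H) ^ 2 + w ^ 2)) := by
    nlinarith [mul_nonneg h0.le (sq_nonneg (l + 2 * H + w))]
  have h3 : -(H * ((l + 2 * H) ^ 2 + w ^ 2)) ≤ 2 * H * (l + H) * w := by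
    nlinarith [mul_nonneg h0.le (sq_nonneg (l + H + w)), mul_nonneg h0.le h0.le,
      mul_nonneg (mul_nonneg h0.le h0.le) hl0.le, mul_nonneg h0.le (mul_nonneg h0.le h0.le)]
  nlinarith [mul_nonneg (sub_nonneg.2 hl) (by positivity : 0 ≤ (l + 2 * H) ^ 2 + w ^ 2)]

lemma inv_le_tsum_inv_sq {c : ℝ} (hc : 0 ≤ c) {t l : ℕ → ℝ} (w : ℝ) (ht : ∀ k, c ≤ t k)
    (hl0 : ∀ k, 0 < l k) (hl : ∀ k, l k ≤ k + 1)
    (hs : Summable fun k ↦ t k / (l k ^ 2 + w ^ 2)) :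
    c / (2 * (1 + |w|)) ≤ ∑' k, t k / (l k ^ 2 + w ^ 2) := by
  have hpos (k : ℕ) : 0 < l k ^ 2 + w ^ 2 := by have := hl0 k; positivity
  set N := ⌊|w|⌋₊ + 1
  have hN0 : (0 : ℝ) < N := by positivity
  have hN1 : |w| ≤ N := by simpa [N] using (Nat.lt_floor_add_one |w|).le
  have hN2 : (N : ℝ) ≤ 1 + |w| := by
    simpa [N, add_comm] using Nat.floor_le (abs_nonneg w)
  have hw : w ^ 2 ≤ (N : ℝ) ^ 2 := by
    rw [← sq_abs]
    gcongr
  calc c / (2 * (1 + |w|)) ≤ c / (2 * N) := by gcongr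
    _ = ∑ k ∈ Finset.range N, c / (2 * N ^ 2) := by
        rw [Finset.sum_const, Finset.card_range, nsmul_eq_mul]
        field_simp
    _ ≤ ∑ k ∈ Finset.range N, t k / (l k ^ 2 + w ^ 2) := by
        refine Finset.sum_le_sum fun k hk ↦ div_le_div₀ (hc.trans (ht k)) (ht k) (hpos k) ?_
        have h1 : (k : ℝ) + 1 ≤ N := by exact_mod_cast Finset.mem_range.1 hk
        have h2 : l k ^ 2 ≤ (N : ℝ) ^ 2 := by
          have := hl0 k
          gcongr
          exact (hl k).trans h1
        linarith
    _ ≤ _ := hs.sum_le_tsum _ fun k _ ↦ div_nonneg (hc.trans (ht k)) (hpos k).le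

lemma le_neg_binomCoeff_mul {α : ℝ} (h1 : 1 < α) (h2 : α < 2) (k : ℕ) :
    α * (α - 1) * (2 - α) / 2 ≤
      -binomCoeff α (k + 1) * ((k + 1 - α / 2) * ((α / 2) ^ 2 - (k + 1 - α / 2) ^ 2)) := by
  have hc : 0 < α * (α - 1) * (2 - α) :=
    mul_pos (mul_pos (by linarith) (by linarith)) (by linarith)
  match k with
  | 0 =>
    rw [binomCoeff_one]
    apply le_of_eq
    push_cast
    ring
  | 1 =>
    rw [binomCoeff_succ, binomCoeff_one]
    push_cast
    nlinarith [mul_pos hc (sub_pos.2 h2)]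
  | k + 2 =>
    have h := le_cube_mul_binomCoeff h1 h2 k
    have hp := (binomCoeff_add_two_pos h1 h2 (k + 1)).le
    have hk := Nat.cast_nonneg (α := ℝ) k
    push_cast
    have e : -binomCoeff α (k + 2 + 1) * (((k : ℝ) + 2 + 1 - α / 2) *
        ((α / 2) ^ 2 - ((k : ℝ) + 2 + 1 - α / 2) ^ 2)) =
        (k + 3) * (k + 3 - α / 2) * (k + 3 - α) * binomCoeff α (k + 3) := by
      ring_nf
    rw [e]
    calc α * (α - 1) * (2 - α) / 2 ≤ (k + 3) * (k + 2) * (k + 1) * binomCoeff α (k + 3) := by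
          linarith
      _ ≤ _ := by
          gcongr
          · exact mul_nonneg (by linarith) (by linarith)
          · linarith
          · linarith

lemma exists_spectrum_nonneg {H : ℝ} (h0 : 0 < H) (h1 : H < 1) : ∃ ε : ℝ, ε ≠ 0 ∧ ∀ w,
    0 ≤ decaySpectrum H ε H w +
      ∑' k : ℕ, -binomCoeff (2 * H) (k + 1) * decaySpectrum H ε (k + 1 - H) w := by
  have hpos (k : ℕ) : 1 - H ≤ k + 1 - H := by linarith [Nat.cast_nonneg (α := ℝ) k]
  rcases le_or_gt H (1 / 2) with hH | hH
  · refine ⟨1, one_ne_zero, fun w ↦ add_nonneg (decaySpectrum_one_nonneg h0 le_rfl w)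
      (tsum_nonneg fun k ↦ mul_nonneg ?_ (decaySpectrum_one_nonneg h0 ?_ w))⟩
    · exact neg_nonneg.2 (binomCoeff_succ_nonpos (by linarith) (by linarith) k)
    · linarith [hpos k]
  have hα1 : 1 < 2 * H := by linarith
  have hα2 : 2 * H < 2 := by linarith
  set b : ℕ → ℝ := fun k ↦ -binomCoeff (2 * H) (k + 1) with hb
  set l : ℕ → ℝ := fun k ↦ k + 1 - H with hl
  have hl0 (k : ℕ) : 0 < l k := (sub_pos.2 h1).trans_le (hpos k)
  have hB := summable_binomCoeff (α := 2 * H) (by linarith) hα2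
  have hkB := summable_mul_binomCoeff hα1 hα2
  have hbs : Summable b := ((summable_nat_add_iff 1).2 hB).neg
  have hbl : HasSum (fun k ↦ b k * l k) (-(∑' k : ℕ, k * binomCoeff (2 * H) k) - H) := by
    have e1 := (hasSum_nat_add_iff' 1).2 hkB.hasSum
    have e2 := (hasSum_nat_add_iff' 1).2 hB.hasSum
    rw [tsum_binomCoeff hα1 hα2] at e2
    convert! e1.neg.add (e2.mul_left H) using 1
    · ext k
      simp only [hb, hl]
      push_cast
      ring
    · simp [binomCoeff_zero]
      ring
  have hbl0 : 0 ≤ H + ∑' k, b k * l k := by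
    rw [hbl.tsum_eq]
    linarith [tsum_mul_binomCoeff_nonpos hα1 hα2]
  have habs : Summable fun k ↦ |b k| * (l k + 1) := by
    refine (hbl.summable.abs.add hbs.abs).congr fun k ↦ ?_
    rw [abs_mul, abs_of_pos (hl0 k)]
    ring
  set c := 2 * H * (2 * H - 1) * (2 - 2 * H) / 2 with hc_def
  have hc : 0 < c := by
    have : 0 < 2 * H - 1 := by linarith
    have : 0 < 2 - 2 * H := by linarith
    positivity
  have ht (k : ℕ) : c ≤ b k * (l k * (H ^ 2 - l k ^ 2)) := by
    have := le_neg_binomCoeff_mul hα1 hα2 k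
    rwa [show 2 * H / 2 = H by ring] at this
  set M := 8 / (1 - H) ^ 2 with hM_def
  have hM : 0 < M := by have := sub_pos.2 h1; positivity
  set S := H + 1 + ∑' k, |b k| * (l k + 1) with hS_def
  have hS : 0 < S := by
    have : 0 ≤ ∑' k, |b k| * (l k + 1) :=
      tsum_nonneg fun k ↦ mul_nonneg (abs_nonneg _) (by linarith [hl0 k])
    linarith
  refine ⟨c / (M * S), by positivity, fun w ↦ ?_⟩
  set D := (H ^ 2 + w ^ 2) * (1 + |w|) with hD_def
  have hD : 0 < D := by positivity
  have hHw : 0 < H ^ 2 + w ^ 2 := by positivity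
  have hodd (x : ℝ) (hx : 1 - H ≤ x) := abs_odd_part_le h0 h1 (sub_pos.2 h1) (by linarith) hx w
  set o : ℝ → ℝ := fun x ↦ w * (1 / (x ^ 2 + w ^ 2) - 1 / ((x + 2 * H) ^ 2 + w ^ 2)) with ho
  have hbo (k : ℕ) : ‖b k * o (l k)‖ ≤ M / D * (|b k| * (l k + 1)) := by
    rw [norm_mul, Real.norm_eq_abs, Real.norm_eq_abs, mul_left_comm]
    exact mul_le_mul_of_nonneg_left (hodd _ (hpos k)) (abs_nonneg _)
  have hos : Summable fun k ↦ b k * o (l k) := .of_norm_bounded (habs.mul_left _) hbo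
  have hoS : |o H + ∑' k, b k * o (l k)| ≤ M / D * S := by
    rw [hS_def, mul_add (M / D)]
    refine (abs_add_le _ _).trans (add_le_add (hodd H (by linarith)) ?_)
    exact tsum_of_norm_bounded (habs.hasSum.mul_left _) hbo
  have hes : Summable fun k ↦ b k * (2 * l k / (l k ^ 2 + w ^ 2)) := by
    refine .of_norm_bounded (hbl.summable.abs.mul_right (2 / (1 - H) ^ 2)) fun k ↦ ?_
    have := sub_pos.2 h1
    have := hl0 k
    rw [show b k * (2 * l k / (l k ^ 2 + w ^ 2)) = b k * l k * (2 / (l k ^ 2 + w ^ 2)) by ring,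
      norm_mul, Real.norm_eq_abs, Real.norm_of_nonneg (by positivity)]
    gcongr
    nlinarith [sq_nonneg w, pow_le_pow_left₀ (sub_pos.2 h1).le (hpos k) 2]
  have hsplit (k : ℕ) : b k * (l k * (H ^ 2 - l k ^ 2)) / (l k ^ 2 + w ^ 2) =
      (H ^ 2 + w ^ 2) / 2 * (b k * (2 * l k / (l k ^ 2 + w ^ 2))) - b k * l k := by
    have : l k ^ 2 + w ^ 2 ≠ 0 := by have := hl0 k; positivity
    field_simp
    ring
  have hts : Summable fun k ↦ b k * (l k * (H ^ 2 - l k ^ 2)) / (l k ^ 2 + w ^ 2) :=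
    ((hes.mul_left _).sub hbl.summable).congr fun k ↦ (hsplit k).symm
  have hlow := inv_le_tsum_inv_sq hc.le w ht hl0 (fun k ↦ by simp only [hl]; linarith) hts
  rw [tsum_congr hsplit, (hes.mul_left _).tsum_sub hbl.summable, tsum_mul_left] at hlow
  have heven : c / D ≤ 2 * H / (H ^ 2 + w ^ 2) + ∑' k, b k * (2 * l k / (l k ^ 2 + w ^ 2)) := by
    have e : c / D = 2 / (H ^ 2 + w ^ 2) * (c / (2 * (1 + |w|))) := by
      rw [hD_def]; field_simp
    have e' : 2 * H / (H ^ 2 + w ^ 2) + ∑' k, b k * (2 * l k / (l k ^ 2 + w ^ 2)) =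
        2 / (H ^ 2 + w ^ 2) * (H + (H ^ 2 + w ^ 2) / 2 *
          ∑' k, b k * (2 * l k / (l k ^ 2 + w ^ 2))) := by
      field_simp
    rw [e, e']
    gcongr
    linarith
  have htotal : ∑' k, b k * decaySpectrum H (c / (M * S)) (l k) w =
      ∑' k, b k * (2 * l k / (l k ^ 2 + w ^ 2)) + c / (M * S) * ∑' k, b k * o (l k) := by
    rw [← tsum_mul_left, ← hes.tsum_add (hos.mul_left _)]
    refine tsum_congr fun k ↦ ?_
    rw [decaySpectrum]
    simp only [ho]
    ring
  have hfin : c / (M * S) * (o H + ∑' k, b k * o (l k)) ≥ -(c / D) := by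
    have h := (abs_le.1 hoS).1
    calc -(c / D) = c / (M * S) * -(M / D * S) := by field_simp
      _ ≤ _ := by gcongr
  change 0 ≤ decaySpectrum H (c / (M * S)) H w +
    ∑' k, b k * decaySpectrum H (c / (M * S)) (l k) w
  rw [htotal, decaySpectrum]
  change 0 ≤ 2 * H / (H ^ 2 + w ^ 2) + c / (M * S) * o H + _
  linarith

lemma star_perturbedKernel (H ε v : ℝ) :
    star (perturbedKernel H ε v) = perturbedKernel H ε (-v) := by
  have h : Ffun H (-v) = Ffun H v := by
    simp [Ffun, neg_div]
  simp only [perturbedKernel, h, abs_neg, mul_neg, Real.sinh_neg, Complex.star_def, map_mul,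
    map_add, map_one, Complex.conj_ofReal, Complex.conj_I]
  push_cast
  ring

open ComplexOrder in
lemma exists_posSemidef_perturbedKernel {H : ℝ} (h0 : 0 < H) (h1 : H < 1) :
    ∃ ε : ℝ, ε ≠ 0 ∧ ∀ (n : ℕ) (x : Fin n → ℝ),
      (Matrix.of fun i j ↦ perturbedKernel H ε (x i - x j)).PosSemidef := by
  obtain ⟨ε, hε, h⟩ := exists_spectrum_nonneg h0 h1
  exact ⟨ε, hε, fun n x ↦ posSemidef_of_fourier_nonneg (continuous_perturbedKernel h0 ε)
    (integrable_perturbedKernel h0 h1 ε) (star_perturbedKernel H ε)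
    (fourier_perturbedKernel h0 h1 ε) (fun w ↦ h (2 * π * w)) x⟩

lemma re_perturbedKernel_mul (H₁ H₂ ε₁ ε₂ v₁ v₂ : ℝ) :
    (perturbedKernel H₁ ε₁ v₁ * perturbedKernel H₂ ε₂ v₂).re =
      4 * Rtheta H₁ H₂ (-(ε₁ * ε₂)) v₁ v₂ := by
  rw [Rtheta, sub_eq_add_neg, Real.exp_add]
  simp only [perturbedKernel, Complex.mul_re, Complex.mul_im, Complex.add_re, Complex.add_im,
    Complex.ofReal_re, Complex.ofReal_im, Complex.one_re, Complex.one_im, Complex.I_re,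
    Complex.I_im]
  ring

/-- For any `H₁, H₂ ∈ (0,1)` there is a nonzero `θ` such that the
kernel `(u,v) ↦ R_θ(u − v)` is positive semidefinite on `ℝ² × ℝ²`. -/
theorem exists_theta_Rtheta_posSemidef (H₁ H₂ : ℝ) (hH₁ : H₁ ∈ Set.Ioo (0:ℝ) 1)
    (hH₂ : H₂ ∈ Set.Ioo (0:ℝ) 1) :
    ∃ θ : ℝ, θ ≠ 0 ∧
      ∀ (n : ℕ) (v : Fin n → ℝ × ℝ) (c : Fin n → ℝ),
        0 ≤ ∑ i : Fin n, ∑ j : Fin n,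
          c i * c j * Rtheta H₁ H₂ θ ((v i).1 - (v j).1) ((v i).2 - (v j).2) := by
  obtain ⟨ε₁, hε₁, h₁⟩ := exists_posSemidef_perturbedKernel hH₁.1 hH₁.2
  obtain ⟨ε₂, hε₂, h₂⟩ := exists_posSemidef_perturbedKernel hH₂.1 hH₂.2
  refine ⟨-(ε₁ * ε₂), neg_ne_zero.2 (mul_ne_zero hε₁ hε₂), fun n v c ↦ ?_⟩
  have h := (((h₁ n fun i ↦ (v i).1).hadamard (h₂ n fun i ↦ (v i).2)).re_dotProduct_nonneg
    fun i ↦ (c i : ℂ))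
  have e : RCLike.re (star (fun i ↦ (c i : ℂ)) ⬝ᵥ
      ((Matrix.of fun i j ↦ perturbedKernel H₁ ε₁ ((v i).1 - (v j).1)).hadamard
        (Matrix.of fun i j ↦ perturbedKernel H₂ ε₂ ((v i).2 - (v j).2))).mulVec
          fun i ↦ (c i : ℂ)) = 4 * ∑ i : Fin n, ∑ j : Fin n,
      c i * c j * Rtheta H₁ H₂ (-(ε₁ * ε₂)) ((v i).1 - (v j).1) ((v i).2 - (v j).2) := by
    simp only [dotProduct, Matrix.mulVec, Matrix.hadamard_apply, Matrix.of_apply, Pi.star_apply,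
      Complex.star_def, Complex.conj_ofReal, RCLike.re_to_complex, Complex.re_sum,
      Complex.re_ofReal_mul, Complex.re_mul_ofReal, re_perturbedKernel_mul, Finset.mul_sum]
    exact Finset.sum_congr rfl fun i _ ↦ Finset.sum_congr rfl fun j _ ↦ by ring
  linarith
end

section
/- Let 1/2 < H < 1. For n ∈ ℕ let C(2H, n) = (∏_{k=0}^{n−1} (2H − k))/n! be the generalized binomial coefficient; for n ≥ 2 one has C(2H, n) = (−1)ⁿ·|C(2H, n)|. Then the series Σ_{n=2}^{∞} n·|C(2H, n)| converges and Σ_{n=2}^{∞} n·|C(2H, n)| = 2H. -/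
open Real

/-- The generalized binomial coefficient `C(α, n) = (∏_{k=0}^{n−1} (α − k)) / n!`. -/
noncomputable def genBinom (α : ℝ) (n : ℕ) : ℝ :=
  (∏ k ∈ Finset.range n, (α - k)) / (n.factorial : ℝ)

open Filter Topology

theorem genBinom_succ (α : ℝ) (n : ℕ) :
    genBinom α (n + 1) = genBinom α n * ((α - n) / (n + 1)) := by
  have hn : (n.factorial : ℝ) ≠ 0 := by positivity
  have hn' : (n : ℝ) + 1 ≠ 0 := by positivity
  simp only [genBinom, Finset.prod_range_succ, Nat.factorial_succ]
  push_cast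
  field_simp

theorem genBinom_add_two (α : ℝ) (n : ℕ) :
    genBinom α (n + 2) = (-1) ^ n * (α * (α - 1) / ((n + 2) * (n + 1)) *
      ∏ k ∈ Finset.range n, (1 - (α - 1) / ((k : ℝ) + 1))) := by
  induction n with
  | zero => simp [genBinom, Finset.prod_range_succ]
  | succ n ih =>
    rw [show n + 1 + 2 = (n + 2) + 1 by ring, genBinom_succ, ih, Finset.prod_range_succ, pow_succ]
    have h₁ : (n : ℝ) + 1 ≠ 0 := by positivity
    have h₂ : (n : ℝ) + 2 ≠ 0 := by positivity
    have h₃ : (n : ℝ) + 2 + 1 ≠ 0 := by positivity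
    have h₄ : (n : ℝ) + 1 + 2 ≠ 0 := by positivity
    have h₅ : (n : ℝ) + 1 + 1 ≠ 0 := by positivity
    push_cast
    field_simp
    ring

theorem one_sub_div_succ_nonneg {b : ℝ} (hb : b ≤ 1) (k : ℕ) :
    0 ≤ 1 - b / ((k : ℝ) + 1) := by
  have hk : (0 : ℝ) ≤ k := k.cast_nonneg
  rw [sub_nonneg, div_le_one (by positivity)]
  linarith

theorem prod_one_sub_div_succ_nonneg {b : ℝ} (hb : b ≤ 1) (n : ℕ) :
    0 ≤ ∏ k ∈ Finset.range n, (1 - b / ((k : ℝ) + 1)) :=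
  Finset.prod_nonneg fun k _ => one_sub_div_succ_nonneg hb k

theorem tendsto_prod_one_sub_div_succ {b : ℝ} (hb₀ : 0 < b) (hb₁ : b ≤ 1) :
    Tendsto (fun n : ℕ => ∏ k ∈ Finset.range n, (1 - b / ((k : ℝ) + 1))) atTop (𝓝 0) := by
  have hlim : Tendsto (fun n : ℕ => exp (-(b * ∑ k ∈ Finset.range n, 1 / ((k : ℝ) + 1))))
      atTop (𝓝 0) :=
    tendsto_exp_neg_atTop_nhds_zero.comp
      (tendsto_sum_range_one_div_nat_succ_atTop.const_mul_atTop hb₀)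
  refine squeeze_zero (prod_one_sub_div_succ_nonneg hb₁) (fun n => ?_) hlim
  rw [Finset.mul_sum, ← Finset.sum_neg_distrib, exp_sum]
  refine Finset.prod_le_prod (fun k _ => one_sub_div_succ_nonneg hb₁ k) fun k _ => ?_
  rw [mul_one_div]
  exact one_sub_le_exp_neg _

theorem abs_genBinom_add_two {α : ℝ} (h₁ : 1 ≤ α) (h₂ : α ≤ 2) (n : ℕ) :
    |genBinom α (n + 2)| = α * (α - 1) / ((n + 2) * (n + 1)) *
      ∏ k ∈ Finset.range n, (1 - (α - 1) / ((k : ℝ) + 1)) := by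
  have hP := prod_one_sub_div_succ_nonneg (b := α - 1) (by linarith) n
  have hα : 0 ≤ α * (α - 1) := mul_nonneg (by linarith) (by linarith)
  rw [genBinom_add_two, abs_mul, abs_pow, abs_neg, abs_one, one_pow, one_mul, abs_of_nonneg]
  positivity

theorem hasSum_mul_abs_genBinom {α : ℝ} (h₁ : 1 < α) (h₂ : α ≤ 2) :
    HasSum (fun n : ℕ => ((n + 2 : ℕ) : ℝ) * |genBinom α (n + 2)|) α := by
  rw [hasSum_iff_tendsto_nat_of_nonneg fun n => by positivity]
  have hterm (n : ℕ) : ((n + 2 : ℕ) : ℝ) * |genBinom α (n + 2)| =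
      α * (∏ k ∈ Finset.range n, (1 - (α - 1) / ((k : ℝ) + 1)) -
        ∏ k ∈ Finset.range (n + 1), (1 - (α - 1) / ((k : ℝ) + 1))) := by
    rw [abs_genBinom_add_two h₁.le h₂, Finset.prod_range_succ]
    push_cast
    field_simp
    ring
  simp_rw [hterm, ← Finset.mul_sum, Finset.sum_range_sub']
  simpa using ((tendsto_prod_one_sub_div_succ (b := α - 1) (by linarith)
    (by linarith)).const_sub 1).const_mul α

/-- For `1/2 < H < 1`, for `n ≥ 2` one has
`C(2H, n) = (−1)ⁿ |C(2H, n)|`, the series `Σ_{n≥2} n |C(2H, n)|` converges and its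
sum equals `2H`. -/
theorem sum_abs_genBinom_eq (H : ℝ) (hH₁ : 1 / 2 < H) (hH₂ : H < 1) :
    (∀ n : ℕ, 2 ≤ n → genBinom (2 * H) n = (-1) ^ n * |genBinom (2 * H) n|)
    ∧ Summable (fun n : ℕ => ((n + 2 : ℕ) : ℝ) * |genBinom (2 * H) (n + 2)|)
    ∧ ∑' n : ℕ, ((n + 2 : ℕ) : ℝ) * |genBinom (2 * H) (n + 2)| = 2 * H := by
  have hsum := hasSum_mul_abs_genBinom (α := 2 * H) (by linarith) (by linarith)
  refine ⟨fun n hn => ?_, hsum.summable, hsum.tsum_eq⟩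
  obtain ⟨m, rfl⟩ := Nat.exists_eq_add_of_le' hn
  rw [abs_genBinom_add_two (by linarith) (by linarith), genBinom_add_two, pow_add]
  simp
end

section
/- Let 1/2 < H < 1 and define b(x) = ∫₀^∞ F_H(v)·(1 − e^{−2Hv})·sin(xv) dv. Then b(x) ≤ 16H² / ( (H² + x²)·x ) for every x ≥ H, and b(x) ≤ 4H / ( (1 − H)·(H² + x²) ) for every x with 0 ≤ x < H. -/
open Real MeasureTheory

theorem integral_period_nonneg {f : ℝ → ℝ} (hf : AntitoneOn f (Set.Ioi 0))
    (hi : IntegrableOn f (Set.Ioi 0)) {x a : ℝ} (hx : 0 < x) (ha : 0 ≤ a) :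
    0 ≤ ∫ v in a..(a + 2 * π / x), f v * sin (x * (v - a)) := by
  have hL : 0 < π / x := by positivity
  have h2L : 2 * π / x = 2 * (π / x) := by ring
  have hfi : IntervalIntegrable f volume a (a + 2 * π / x) := by
    rw [intervalIntegrable_iff_integrableOn_Ioc_of_le (by rw [h2L]; linarith)]
    exact hi.mono_set fun v hv => lt_of_le_of_lt ha hv.1
  have hs : Continuous fun v : ℝ => sin (x * (v - a)) := by fun_prop
  have hzero : ∫ v in a..(a + 2 * π / x), sin (x * (v - a)) = 0 := by
    have := intervalIntegral.integral_comp_mul_add (a := a) (b := a + 2 * π / x) (fun u => sin u)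
      hx.ne' (-(x * a))
    have e : ∀ v, x * (v - a) = x * v + -(x * a) := fun v => by ring
    simp_rw [e, this, integral_sin]
    have e1 : x * a + -(x * a) = 0 := by ring
    have e2 : x * (a + 2 * π / x) + -(x * a) = 2 * π := by field_simp; ring
    simp [e1, e2]
  have key : 0 ≤ ∫ v in a..(a + 2 * π / x), (f v - f (a + π / x)) * sin (x * (v - a)) := by
    refine intervalIntegral.integral_nonneg (by rw [h2L]; linarith) fun v hv => ?_
    rcases hv.1.eq_or_lt with rfl | hav
    · simp
    have hc : (a + π / x) ∈ Set.Ioi (0 : ℝ) := by simp only [Set.mem_Ioi]; linarith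
    have hv0 : v ∈ Set.Ioi (0 : ℝ) := lt_of_le_of_lt ha hav
    have hxL : x * (π / x) = π := by field_simp
    rcases le_total v (a + π / x) with h | h
    · refine mul_nonneg (sub_nonneg.2 (hf hv0 hc h)) (sin_nonneg_of_nonneg_of_le_pi ?_ ?_)
      · exact mul_nonneg hx.le (by linarith)
      · nlinarith
    · refine mul_nonneg_of_nonpos_of_nonpos (sub_nonpos.2 (hf hc hv0 h)) ?_
      have h3 : v - a ≤ 2 * (π / x) := by have := hv.2; rw [h2L] at this; linarith
      rw [← sin_sub_two_pi]
      exact sin_nonpos_of_nonpos_of_neg_pi_le (by nlinarith) (by nlinarith)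
  have e : (fun v => (f v - f (a + π / x)) * sin (x * (v - a))) =
      fun v => f v * sin (x * (v - a)) - f (a + π / x) * sin (x * (v - a)) := by
    ext v; ring
  rw [e, intervalIntegral.integral_sub (hfi.mul_continuousOn hs.continuousOn)
    (Continuous.intervalIntegrable (by fun_prop) _ _), intervalIntegral.integral_const_mul, hzero] at key
  simpa using key

theorem integrableOn_mul_sin {f : ℝ → ℝ} {s : Set ℝ} (hi : IntegrableOn f s) (x c : ℝ) :
    IntegrableOn (fun v => f v * sin (x * (v - c))) s :=
  hi.mul_bdd (c := 1) (by fun_prop) (.of_forall fun v => by simpa using abs_sin_le_one _)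

theorem integral_Ioi_mul_sin_nonneg {f : ℝ → ℝ} (hf : AntitoneOn f (Set.Ioi 0))
    (hi : IntegrableOn f (Set.Ioi 0)) {x a : ℝ} (hx : 0 < x) (ha : 0 ≤ a) :
    0 ≤ ∫ v in Set.Ioi a, f v * sin (x * (v - a)) := by
  have hint := integrableOn_mul_sin (hi.mono_set (Set.Ioi_subset_Ioi ha)) x a
  have hT : 0 < 2 * π / x := by positivity
  have hlim : Filter.Tendsto (fun n : ℕ => a + n * (2 * π / x)) Filter.atTop Filter.atTop :=
    Filter.tendsto_atTop_add_const_left _ _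
      (tendsto_natCast_atTop_atTop.atTop_mul_const hT)
  have := intervalIntegral_tendsto_integral_Ioi a hint hlim
  refine ge_of_tendsto' this fun n => ?_
  have hloc : ∀ c d : ℝ, a ≤ c → a ≤ d →
      IntervalIntegrable (fun v => f v * sin (x * (v - a))) volume c d := fun c d hc hd =>
    intervalIntegrable_iff.2 (hint.mono_set fun _ hv => lt_of_le_of_lt (le_min hc hd) hv.1)
  induction n with
  | zero => simp
  | succ n ih =>
    have hn : 0 ≤ (n : ℝ) * (2 * π / x) := by positivity
    have hstep := integral_period_nonneg hf hi hx (a := a + n * (2 * π / x)) (by linarith)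
    have e : a + ((n + 1 : ℕ) : ℝ) * (2 * π / x) = a + n * (2 * π / x) + 2 * π / x := by
      push_cast; ring
    rw [e, ← intervalIntegral.integral_add_adjacent_intervals (hloc _ _ le_rfl (by linarith))
      (hloc (a + n * (2 * π / x)) _ (by linarith) (by linarith))]
    refine add_nonneg ih (hstep.trans_eq (intervalIntegral.integral_congr fun v _ => ?_))
    have e2 : x * (v - (a + n * (2 * π / x))) = x * (v - a) - n * (2 * π) := by
      field_simp; ring
    simp only [e2, sin_sub_nat_mul_two_pi]

theorem integral_Ioi_mul_sin_le {f : ℝ → ℝ} (hf : AntitoneOn f (Set.Ioi 0))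
    (hi : IntegrableOn f (Set.Ioi 0)) {M : ℝ} (hM : ∀ v, 0 < v → f v ≤ M) {x : ℝ} (hx : 0 < x) :
    ∫ v in Set.Ioi 0, f v * sin (x * v) ≤ 2 * M / x := by
  have hL : 0 < π / x := by positivity
  have hxL : x * (π / x) = π := by field_simp
  have hint : IntegrableOn (fun v => f v * sin (x * v)) (Set.Ioi 0) := by
    simpa using integrableOn_mul_sin hi x 0
  have htail := integral_Ioi_mul_sin_nonneg hf hi hx hL.le
  have e : ∀ v, sin (x * (v - π / x)) = - sin (x * v) := fun v => by
    rw [mul_sub, hxL, sin_sub_pi]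
  simp_rw [e, mul_neg, integral_neg] at htail
  have hI : IntervalIntegrable (fun v => f v * sin (x * v)) volume 0 (π / x) := by
    rw [intervalIntegrable_iff_integrableOn_Ioc_of_le hL.le]
    exact hint.mono_set Set.Ioc_subset_Ioi_self
  have hhead : ∫ v in (0 : ℝ)..(π / x), f v * sin (x * v) ≤
      ∫ v in (0 : ℝ)..(π / x), M * sin (x * v) := by
    refine intervalIntegral.integral_mono_on hL.le hI
      (Continuous.intervalIntegrable (by fun_prop) _ _) fun v hv => ?_
    rcases hv.1.eq_or_lt with rfl | h0
    · simp
    · exact mul_le_mul_of_nonneg_right (hM v h0) (sin_nonneg_of_nonneg_of_le_pi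
        (mul_nonneg hx.le h0.le) (by nlinarith [hv.2]))
  have hval : ∫ v in (0 : ℝ)..(π / x), M * sin (x * v) = 2 * M / x := by
    rw [intervalIntegral.integral_const_mul, intervalIntegral.integral_comp_mul_left _ hx.ne', hxL]
    simp
    ring
  rw [← intervalIntegral.integral_interval_add_Ioi hint (hint.mono_set (Set.Ioi_subset_Ioi hL.le))]
  linarith

theorem integral_exp_mul_sin {a : ℝ} (ha : 0 < a) (x : ℝ) :
    ∫ v in Set.Ioi 0, exp (-(a * v)) * sin (x * v) = x / (a ^ 2 + x ^ 2) := by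
  have hd : 0 < a ^ 2 + x ^ 2 := by positivity
  have hint : IntegrableOn (fun v => exp (-(a * v)) * sin (x * v)) (Set.Ioi 0) := by
    have := integrableOn_mul_sin (exp_neg_integrableOn_Ioi 0 ha) x 0
    simpa using this
  have hder : ∀ v ∈ Set.Ici (0 : ℝ), HasDerivAt
      (fun v => -(exp (-(a * v)) * (a * sin (x * v) + x * cos (x * v))) / (a ^ 2 + x ^ 2))
      (exp (-(a * v)) * sin (x * v)) v := by
    intro v _
    have h1 : HasDerivAt (fun v => exp (-(a * v))) (exp (-(a * v)) * -a) v := by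
      simpa using ((hasDerivAt_id v).const_mul a).neg.exp
    have h2 : HasDerivAt (fun v => sin (x * v)) (cos (x * v) * x) v := by
      simpa using ((hasDerivAt_id v).const_mul x).sin
    have h3 : HasDerivAt (fun v => cos (x * v)) (-sin (x * v) * x) v := by
      simpa using ((hasDerivAt_id v).const_mul x).cos
    refine ((h1.mul ((h2.const_mul a).add (h3.const_mul x))).neg.div_const
      (a ^ 2 + x ^ 2)).congr_deriv ?_
    simp only [Pi.add_apply]
    field_simp
    ring
  have hlim : Filter.Tendsto
      (fun v => -(exp (-(a * v)) * (a * sin (x * v) + x * cos (x * v))) / (a ^ 2 + x ^ 2))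
      Filter.atTop (nhds 0) := by
    have h0 : Filter.Tendsto (fun v => exp (-(a * v))) Filter.atTop (nhds 0) :=
      tendsto_exp_neg_atTop_nhds_zero.comp (Filter.tendsto_id.const_mul_atTop ha)
    have := (h0.zero_mul_isBoundedUnder_le (g := fun v => a * sin (x * v) + x * cos (x * v))
      (Filter.isBoundedUnder_of ⟨|a| + |x|, fun v => ?_⟩)).neg.div_const (a ^ 2 + x ^ 2)
    · simpa using this
    · simp only [Function.comp, norm_eq_abs]
      refine (abs_add_le _ _).trans (add_le_add ?_ ?_) <;> rw [abs_mul]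
      · exact mul_le_of_le_one_right (abs_nonneg _) (abs_sin_le_one _)
      · exact mul_le_of_le_one_right (abs_nonneg _) (abs_cos_le_one _)
  rw [integral_Ioi_of_hasDerivAt_of_tendsto' hder hint hlim]
  simp
  ring

theorem exp_neg_mem_Ioo {v : ℝ} (hv : 0 < v) : exp (-v) ∈ Set.Ioo (0 : ℝ) 1 :=
  ⟨exp_pos _, exp_lt_one_iff.2 (by linarith)⟩

theorem antitoneOn_comp_exp_neg {g : ℝ → ℝ} (hg : MonotoneOn g (Set.Ioo 0 1)) :
    AntitoneOn (fun v => g (exp (-v))) (Set.Ioi 0) := fun _ hv _ hw hvw =>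
  hg (exp_neg_mem_Ioo hw) (exp_neg_mem_Ioo hv) (exp_le_exp.2 (neg_le_neg hvw))

theorem exp_neg_rpow (v a : ℝ) : exp (-v) ^ a = exp (-(a * v)) := by
  rw [← exp_mul]; ring_nf

theorem integrableOn_exp_neg_mul {a : ℝ} (ha : 0 < a) :
    IntegrableOn (fun v => exp (-(a * v))) (Set.Ioi 0) := by
  simpa using exp_neg_integrableOn_Ioi 0 ha

theorem integrableOn_comp_exp_neg {g : ℝ → ℝ} (hg : MonotoneOn g (Set.Ioo 0 1)) {C a : ℝ}
    (ha : 0 < a) (h0 : ∀ s ∈ Set.Ioo (0 : ℝ) 1, 0 ≤ g s)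
    (hC : ∀ s ∈ Set.Ioo (0 : ℝ) 1, g s ≤ C * s ^ a) :
    IntegrableOn (fun v => g (exp (-v))) (Set.Ioi 0) := by
  refine ((integrableOn_exp_neg_mul ha).const_mul C).mono'
    (aemeasurable_restrict_of_antitoneOn measurableSet_Ioi
      (antitoneOn_comp_exp_neg hg)).aestronglyMeasurable
    ((ae_restrict_iff' measurableSet_Ioi).2 (.of_forall fun v hv => ?_))
  have hs := exp_neg_mem_Ioo hv
  rw [norm_eq_abs, abs_of_nonneg (h0 _ hs), ← exp_neg_rpow]
  exact hC _ hs

/-- The part of the kernel governed by the secant slope of `s ↦ s ^ (2H)` at `1`. -/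
noncomputable def slopePart (H s : ℝ) : ℝ :=
  2 * H * (2 * H - 1) * s ^ (1 - H) * ((1 - s ^ (2 * H)) / (1 - s))

/-- The monotone part of the kernel, whose sine transform is discarded. -/
noncomputable def discardedPart (H s : ℝ) : ℝ :=
  (1 - (1 - s) ^ (2 * H - 1)) * slopePart H s
    + 8 * H ^ 2 * s ^ (1 + H) * (1 - (1 - s) ^ (2 * H - 1) - (2 * H - 1) * s)

theorem slopePart_nonneg {H s : ℝ} (hH₁ : 1 / 2 < H) (hs : s ∈ Set.Ioo (0 : ℝ) 1) :
    0 ≤ slopePart H s := by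
  have h1 : s ^ (2 * H) ≤ 1 := rpow_le_one hs.1.le hs.2.le (by linarith)
  have h2 : 0 ≤ (1 - s ^ (2 * H)) / (1 - s) :=
    div_nonneg (by linarith) (by linarith [hs.2])
  have h3 : 0 ≤ 2 * H * (2 * H - 1) := mul_nonneg (by linarith) (by linarith)
  exact mul_nonneg (mul_nonneg h3 (rpow_nonneg hs.1.le _)) h2

theorem slopePart_le {H s : ℝ} (hH₁ : 1 / 2 < H) (hs : s ∈ Set.Ioo (0 : ℝ) 1) :
    slopePart H s ≤ 4 * H ^ 2 * (2 * H - 1) * s ^ (1 - H) := by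
  have h1 := one_add_mul_self_le_rpow_one_add (s := s - 1) (by linarith [hs.1])
    (p := 2 * H) (by linarith)
  rw [add_sub_cancel] at h1
  have h2 : (1 - s ^ (2 * H)) / (1 - s) ≤ 2 * H := by
    rw [div_le_iff₀ (by linarith [hs.2])]; linarith
  have h3 : 0 ≤ 2 * H * (2 * H - 1) := mul_nonneg (by linarith) (by linarith)
  refine (mul_le_mul_of_nonneg_left h2 (mul_nonneg h3 (rpow_nonneg hs.1.le _))).trans_eq ?_
  ring

theorem slopePart_monotoneOn {H : ℝ} (hH₁ : 1 / 2 < H) (hH₂ : H < 1) :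
    MonotoneOn (slopePart H) (Set.Ioo 0 1) := by
  intro s hs t ht hst
  have h1 := (convexOn_rpow (p := 2 * H) (by linarith)).secant_mono (a := 1) (x := s) (y := t)
    (by simp) hs.1.le ht.1.le hs.2.ne ht.2.ne hst
  have e : ∀ u : ℝ, (1 - u ^ (2 * H)) / (1 - u) = (u ^ (2 * H) - 1 ^ (2 * H)) / (u - 1) := by
    intro u
    rw [one_rpow, ← neg_sub, ← neg_sub u 1, neg_div_neg_eq]
  have h3 : 0 ≤ 2 * H * (2 * H - 1) := mul_nonneg (by linarith) (by linarith)
  have h4 : s ^ (1 - H) ≤ t ^ (1 - H) := rpow_le_rpow hs.1.le hst (by linarith)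
  have h5 : 0 ≤ (1 - s ^ (2 * H)) / (1 - s) :=
    div_nonneg (sub_nonneg.2 (rpow_le_one hs.1.le hs.2.le (by linarith))) (by linarith [hs.2])
  refine mul_le_mul (mul_le_mul_of_nonneg_left h4 h3) ?_ h5
    (mul_nonneg h3 (rpow_nonneg ht.1.le _))
  rw [e, e]; exact h1

theorem one_sub_rpow_sub_nonneg {p s : ℝ} (hp₀ : 0 ≤ p) (hp₁ : p ≤ 1)
    (hs : s ∈ Set.Ioo (0 : ℝ) 1) : 0 ≤ 1 - (1 - s) ^ p - p * s := by
  have := rpow_one_add_le_one_add_mul_self (s := -s) (by linarith [hs.2]) hp₀ hp₁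
  rw [← sub_eq_add_neg] at this
  linarith

theorem one_sub_rpow_sub_monotoneOn {p : ℝ} (hp₀ : 0 ≤ p) (hp₁ : p ≤ 1) :
    MonotoneOn (fun s : ℝ => 1 - (1 - s) ^ p - p * s) (Set.Ioo 0 1) := by
  intro s hs t ht hst
  have hs' : 0 < 1 - s := by linarith [hs.2]
  have ht' : 0 < 1 - t := by linarith [ht.2]
  have hu : (1 - t) / (1 - s) = 1 + (s - t) / (1 - s) := by field_simp; ring
  have h1 := rpow_one_add_le_one_add_mul_self (s := (s - t) / (1 - s))
    (by have := div_pos ht' hs'; linarith) hp₀ hp₁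
  rw [← hu, div_rpow ht'.le hs'.le, div_le_iff₀ (rpow_pos_of_pos hs' _)] at h1
  have h2 : 1 - s ≤ (1 - s) ^ p := by
    simpa using rpow_le_rpow_of_exponent_ge hs' (by linarith [hs.1]) hp₁
  have h3 : p * (t - s) * (1 - s) ≤ p * (t - s) * (1 - s) ^ p :=
    mul_le_mul_of_nonneg_left h2 (mul_nonneg hp₀ (by linarith))
  have h4 : p * (t - s) ≤ p * ((t - s) / (1 - s)) * (1 - s) ^ p := by
    rw [← mul_le_mul_iff_of_pos_right hs']
    refine h3.trans_eq ?_
    field_simp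
  have h5 : (1 + p * ((s - t) / (1 - s))) * (1 - s) ^ p =
      (1 - s) ^ p - p * ((t - s) / (1 - s)) * (1 - s) ^ p := by ring
  simp only
  linarith

theorem discardedPart_nonneg {H s : ℝ} (hH₁ : 1 / 2 < H) (hH₂ : H < 1)
    (hs : s ∈ Set.Ioo (0 : ℝ) 1) : 0 ≤ discardedPart H s := by
  have h1 := one_sub_rpow_sub_nonneg (p := 2 * H - 1) (by linarith) (by linarith) hs
  have h2 : (1 - s) ^ (2 * H - 1) ≤ 1 :=
    rpow_le_one (by linarith [hs.2]) (by linarith [hs.1]) (by linarith)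
  exact add_nonneg (mul_nonneg (by linarith) (slopePart_nonneg hH₁ hs))
    (mul_nonneg (mul_nonneg (by positivity) (rpow_nonneg hs.1.le _)) h1)

theorem discardedPart_monotoneOn {H : ℝ} (hH₁ : 1 / 2 < H) (hH₂ : H < 1) :
    MonotoneOn (discardedPart H) (Set.Ioo 0 1) := by
  intro s hs t ht hst
  have h1 := one_sub_rpow_sub_nonneg (p := 2 * H - 1) (by linarith) (by linarith) hs
  have h2 : (1 - t) ^ (2 * H - 1) ≤ (1 - s) ^ (2 * H - 1) :=
    rpow_le_rpow (by linarith [ht.2]) (by linarith) (by linarith)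
  have h3 : (1 - t) ^ (2 * H - 1) ≤ 1 :=
    rpow_le_one (by linarith [ht.2]) (by linarith [ht.1]) (by linarith)
  have h4 := one_sub_rpow_sub_monotoneOn (p := 2 * H - 1) (by linarith) (by linarith) hs ht hst
  have h5 : s ^ (1 + H) ≤ t ^ (1 + H) := rpow_le_rpow hs.1.le hst (by linarith)
  refine add_le_add (mul_le_mul (by linarith) (slopePart_monotoneOn hH₁ hH₂ hs ht hst)
    (slopePart_nonneg hH₁ hs) (by linarith)) (mul_le_mul ?_ h4 h1 ?_)
  · exact mul_le_mul_of_nonneg_left h5 (by positivity)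
  · exact mul_nonneg (by positivity) (rpow_nonneg ht.1.le _)

theorem discardedPart_le {H s : ℝ} (hH₁ : 1 / 2 < H) (hH₂ : H < 1)
    (hs : s ∈ Set.Ioo (0 : ℝ) 1) :
    discardedPart H s ≤ (4 * H ^ 2 * (2 * H - 1) + 8 * H ^ 2) * s ^ (1 - H) := by
  have h1 : 0 ≤ (1 - s) ^ (2 * H - 1) := rpow_nonneg (by linarith [hs.2]) _
  have h2 := slopePart_nonneg hH₁ hs
  have h3 : s ^ (1 + H) ≤ s ^ (1 - H) :=
    rpow_le_rpow_of_exponent_ge hs.1 hs.2.le (by linarith)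
  have h4 : 0 ≤ 8 * H ^ 2 * s ^ (1 + H) := mul_nonneg (by positivity) (rpow_nonneg hs.1.le _)
  have h5 : 0 ≤ (2 * H - 1) * s := mul_nonneg (by linarith) hs.1.le
  calc discardedPart H s ≤ 1 * slopePart H s + 8 * H ^ 2 * s ^ (1 + H) * 1 :=
        add_le_add (mul_le_mul_of_nonneg_right (by linarith) h2)
          (mul_le_mul_of_nonneg_left (by linarith) h4)
    _ ≤ 4 * H ^ 2 * (2 * H - 1) * s ^ (1 - H) + 8 * H ^ 2 * s ^ (1 - H) := by
        rw [one_mul, mul_one]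
        exact add_le_add (slopePart_le hH₁ hs) (mul_le_mul_of_nonneg_left h3 (by positivity))
    _ = _ := by ring

/-- The function `F_H(v) (1 - e^{-2Hv})`, extended from `v > 0` to the real line. -/
noncomputable def weight (H v : ℝ) : ℝ :=
  (exp (H * v) - exp (-(H * v))) * (1 - (1 - exp (-v)) ^ (2 * H))
    + exp (-(H * v)) - exp (-(3 * H * v))

/-- The derivative of `weight H`. -/
noncomputable def weightDeriv (H v : ℝ) : ℝ :=
  H * (exp (H * v) + exp (-(H * v))) * (1 - (1 - exp (-v)) ^ (2 * H))
    - (exp (H * v) - exp (-(H * v))) * (2 * H * exp (-v) * (1 - exp (-v)) ^ (2 * H - 1))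
    - H * exp (-(H * v)) + 3 * H * exp (-(3 * H * v))

/-- The function `H ^ 2 * weight H` minus the second derivative of `weight H`. -/
noncomputable def kernel (H v : ℝ) : ℝ :=
  8 * H ^ 2 * exp (-(3 * H * v)) + 8 * H ^ 2 * exp (-((1 + H) * v))
    - 8 * H ^ 2 * (2 * H - 1) * exp (-((2 + H) * v))
    + slopePart H (exp (-v)) - discardedPart H (exp (-v))

theorem Ffun_mul_eq_weight {H v : ℝ} (hv : 0 < v) :
    Ffun H v * (1 - exp (-(2 * H * v))) = weight H v := by
  have hs : 0 ≤ 1 - exp (-v) := sub_nonneg.2 (exp_le_one_iff.2 (by linarith))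
  have h1 : 2 * sinh (v / 2) = exp (v / 2) * (1 - exp (-v)) := by
    rw [sinh_eq, mul_sub, ← exp_add]; ring_nf
  have h2 : |2 * sinh (v / 2)| ^ (2 * H) = exp (H * v) * (1 - exp (-v)) ^ (2 * H) := by
    rw [h1, abs_of_nonneg (mul_nonneg (exp_pos _).le hs), mul_rpow (exp_pos _).le hs, ← exp_mul]
    ring_nf
  have h3 : exp (-(2 * H * v)) = exp (-(H * v)) ^ 2 := by rw [← exp_nat_mul]; push_cast; ring_nf
  have h4 : exp (-(3 * H * v)) = exp (-(H * v)) ^ 3 := by rw [← exp_nat_mul]; push_cast; ring_nf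
  have h5 : exp (H * v) * exp (-(H * v)) = 1 := by rw [← exp_add]; simp
  rw [Ffun, weight, h2, cosh_eq, h3, h4]
  linear_combination (-exp (-(H * v)) * (1 - (1 - exp (-v)) ^ (2 * H))) * h5

theorem hasDerivAt_exp_const_mul (c v : ℝ) :
    HasDerivAt (fun v => exp (c * v)) (c * exp (c * v)) v := by
  simpa [mul_comm] using ((hasDerivAt_id v).const_mul c).exp

theorem hasDerivAt_exp_neg_const_mul (c v : ℝ) :
    HasDerivAt (fun v => exp (-(c * v))) (-c * exp (-(c * v))) v := by
  simpa using hasDerivAt_exp_const_mul (-c) v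

theorem hasDerivAt_one_sub_exp_neg_rpow {v : ℝ} (hv : 0 < v) (p : ℝ) :
    HasDerivAt (fun v => (1 - exp (-v)) ^ p) (p * exp (-v) * (1 - exp (-v)) ^ (p - 1)) v := by
  have hs : 0 < 1 - exp (-v) := sub_pos.2 (exp_neg_mem_Ioo hv).2
  have h := (hasDerivAt_exp_neg_const_mul 1 v).const_sub 1
  simp only [one_mul, neg_mul, neg_neg] at h
  convert h.rpow_const (p := p) (Or.inl hs.ne') using 1
  ring

theorem hasDerivAt_weight {H v : ℝ} (hv : 0 < v) :
    HasDerivAt (weight H) (weightDeriv H v) v := by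
  have h1 := hasDerivAt_exp_const_mul H v
  have h2 := hasDerivAt_exp_neg_const_mul H v
  have h3 := hasDerivAt_exp_neg_const_mul (3 * H) v
  have h4 := hasDerivAt_one_sub_exp_neg_rpow hv (2 * H)
  refine ((((h1.sub h2).mul (h4.const_sub 1)).add h2).sub h3).congr_deriv ?_
  simp only [weightDeriv, Pi.sub_apply]
  ring

theorem hasDerivAt_weightDeriv {H v : ℝ} (hv : 0 < v) :
    HasDerivAt (weightDeriv H) (H ^ 2 * weight H v - kernel H v) v := by
  have hs : 0 < 1 - exp (-v) := sub_pos.2 (exp_neg_mem_Ioo hv).2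
  have h1 := hasDerivAt_exp_const_mul H v
  have h2 := hasDerivAt_exp_neg_const_mul H v
  have h3 := hasDerivAt_exp_neg_const_mul (3 * H) v
  have h4 := hasDerivAt_one_sub_exp_neg_rpow hv (2 * H)
  have h5 := hasDerivAt_one_sub_exp_neg_rpow hv (2 * H - 1)
  have h6 := hasDerivAt_exp_neg_const_mul 1 v
  simp only [one_mul] at h6
  refine ((((((h1.add h2).const_mul H).mul (h4.const_sub 1)).sub
    ((h1.sub h2).mul ((h6.const_mul (2 * H)).mul h5))).sub (h2.const_mul H)).add
      (h3.const_mul (3 * H))).congr_deriv ?_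
  have e1 : (1 - exp (-v)) ^ (2 * H) = (1 - exp (-v)) ^ (2 * H - 1) * (1 - exp (-v)) := by
    rw [← rpow_add_one hs.ne']; ring_nf
  have e2 : (1 - exp (-v)) ^ (2 * H - 1 - 1) = (1 - exp (-v)) ^ (2 * H - 1) / (1 - exp (-v)) := by
    rw [rpow_sub_one hs.ne']
  have e3 : exp (-v) ^ (1 - H) = exp (-v) * exp (H * v) := by
    rw [exp_neg_rpow, ← exp_add]; ring_nf
  have e4 : exp (-v) ^ (2 * H) = (exp (H * v))⁻¹ ^ 2 := by
    rw [exp_neg_rpow, ← exp_neg, ← exp_nat_mul]; push_cast; ring_nf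
  have e5 : exp (-v) ^ (1 + H) = exp (-v) * (exp (H * v))⁻¹ := by
    rw [exp_neg_rpow, ← exp_neg, ← exp_add]; ring_nf
  have e6 : exp (-(3 * H * v)) = (exp (H * v))⁻¹ ^ 3 := by
    rw [← exp_neg, ← exp_nat_mul]; push_cast; ring_nf
  have e7 : exp (-((2 + H) * v)) = exp (-v) ^ 2 * (exp (H * v))⁻¹ := by
    rw [← exp_neg, ← exp_nat_mul, ← exp_add]; push_cast; ring_nf
  have e8 : exp (-((1 + H) * v)) = exp (-v) * (exp (H * v))⁻¹ := by
    rw [← exp_neg, ← exp_add]; ring_nf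
  have e9 : exp (-(H * v)) = (exp (H * v))⁻¹ := exp_neg _
  simp only [weight, kernel, slopePart, discardedPart, Pi.sub_apply, Pi.add_apply, Pi.mul_apply]
  rw [e1, e2, e3, e4, e5, e6, e7, e8, e9]
  have hp := exp_pos (H * v)
  generalize exp (H * v) = p at *
  generalize (1 - exp (-v)) ^ (2 * H - 1) = q at *
  generalize exp (-v) = s at *
  have hs' := hs.ne'
  field_simp
  ring

theorem one_sub_rpow_mem_Icc {H v : ℝ} (hH₁ : 1 / 2 < H) (hv : 0 < v) :
    1 - (1 - exp (-v)) ^ (2 * H) ∈ Set.Icc 0 (2 * H * exp (-v)) := by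
  have hs := (exp_neg_mem_Ioo hv).2
  have h0 := exp_pos (-v)
  have h1 := one_add_mul_self_le_rpow_one_add (s := -exp (-v)) (by linarith)
    (p := 2 * H) (by linarith)
  rw [← sub_eq_add_neg] at h1
  have h2 : (1 - exp (-v)) ^ (2 * H) ≤ 1 := rpow_le_one (by linarith) (by linarith) (by linarith)
  constructor <;> linarith

theorem exp_neg_le_exp_neg_one_sub {H v c : ℝ} (hv : 0 < v) (hc : 1 - H ≤ c) :
    exp (-(c * v)) ≤ exp (-((1 - H) * v)) :=
  exp_le_exp.2 (neg_le_neg (mul_le_mul_of_nonneg_right hc hv.le))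

theorem abs_weight_le {H v : ℝ} (hH₁ : 1 / 2 < H) (hH₂ : H < 1) (hv : 0 < v) :
    |weight H v| ≤ 3 * exp (-((1 - H) * v)) := by
  obtain ⟨h1, h2⟩ := one_sub_rpow_mem_Icc hH₁ hv
  have h3 : exp (-(H * v)) ≤ exp (H * v) := exp_le_exp.2 (by nlinarith)
  have h4 : exp (-(3 * H * v)) ≤ exp (-(H * v)) := exp_le_exp.2 (by nlinarith)
  have h5 := exp_neg_le_exp_neg_one_sub (H := H) (c := H) hv (by linarith)
  have h6 : exp (H * v) * exp (-v) = exp (-((1 - H) * v)) := by rw [← exp_add]; ring_nf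
  have h7 := exp_pos (-(3 * H * v))
  have h8 := exp_pos (-(H * v))
  have h9 := exp_pos (-((1 - H) * v))
  have h10 : 0 ≤ (exp (H * v) - exp (-(H * v))) * (1 - (1 - exp (-v)) ^ (2 * H)) :=
    mul_nonneg (by linarith) h1
  have h11 : (exp (H * v) - exp (-(H * v))) * (1 - (1 - exp (-v)) ^ (2 * H)) ≤
      exp (H * v) * (2 * H * exp (-v)) := mul_le_mul (by linarith) h2 h1 (exp_pos _).le
  rw [weight, abs_of_nonneg (by linarith)]
  nlinarith

theorem abs_weightDeriv_le {H v : ℝ} (hH₁ : 1 / 2 < H) (hH₂ : H < 1) (hv : 0 < v) :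
    |weightDeriv H v| ≤ 10 * exp (-((1 - H) * v)) := by
  obtain ⟨h1, h2⟩ := one_sub_rpow_mem_Icc hH₁ hv
  have hs := (exp_neg_mem_Ioo hv).2
  have h3 : exp (-(H * v)) ≤ exp (H * v) := exp_le_exp.2 (by nlinarith)
  have h4 := exp_neg_le_exp_neg_one_sub (H := H) (c := 3 * H) hv (by linarith)
  have h5 := exp_neg_le_exp_neg_one_sub (H := H) (c := H) hv (by linarith)
  have h6 : exp (H * v) * exp (-v) = exp (-((1 - H) * v)) := by rw [← exp_add]; ring_nf
  have h7 := exp_pos (-(3 * H * v))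
  have h8 := exp_pos (-(H * v))
  have h9 := exp_pos (-((1 - H) * v))
  have h0 := exp_pos (-v)
  have h10 : 0 ≤ H * (exp (H * v) + exp (-(H * v))) * (1 - (1 - exp (-v)) ^ (2 * H)) :=
    mul_nonneg (mul_nonneg (by linarith) (by linarith)) h1
  have h11 : H * (exp (H * v) + exp (-(H * v))) * (1 - (1 - exp (-v)) ^ (2 * H)) ≤
      (2 * exp (H * v)) * (2 * exp (-v)) :=
    mul_le_mul (by nlinarith) (by nlinarith) h1 (by linarith)
  have h12 : 0 ≤ (1 - exp (-v)) ^ (2 * H - 1) := rpow_nonneg (by linarith) _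
  have h13 : (1 - exp (-v)) ^ (2 * H - 1) ≤ 1 :=
    rpow_le_one (by linarith) (by linarith) (by linarith)
  have h14 : 0 ≤ 2 * H * exp (-v) * (1 - exp (-v)) ^ (2 * H - 1) :=
    mul_nonneg (mul_nonneg (by linarith) h0.le) h12
  have h15 : 2 * H * exp (-v) * (1 - exp (-v)) ^ (2 * H - 1) ≤ 2 * exp (-v) * 1 :=
    mul_le_mul (by nlinarith) h13 h12 (by linarith)
  have h16 : 0 ≤ (exp (H * v) - exp (-(H * v))) *
      (2 * H * exp (-v) * (1 - exp (-v)) ^ (2 * H - 1)) := mul_nonneg (by linarith) h14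
  have h17 : (exp (H * v) - exp (-(H * v))) *
      (2 * H * exp (-v) * (1 - exp (-v)) ^ (2 * H - 1)) ≤ exp (H * v) * (2 * exp (-v) * 1) :=
    mul_le_mul (by linarith) h15 h14 (exp_pos _).le
  have h18 : 0 ≤ H * exp (-(H * v)) := by positivity
  have h19 : H * exp (-(H * v)) ≤ exp (-((1 - H) * v)) := by nlinarith
  have h20 : 0 ≤ 3 * H * exp (-(3 * H * v)) := by positivity
  have h21 : 3 * H * exp (-(3 * H * v)) ≤ 3 * exp (-((1 - H) * v)) := by nlinarith
  rw [weightDeriv, abs_le]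
  constructor <;> linarith

theorem continuous_weight {H : ℝ} (hH₁ : 1 / 2 < H) : Continuous (weight H) := by
  have h : Continuous fun v : ℝ => (1 - exp (-v)) ^ (2 * H) :=
    Continuous.rpow_const (by fun_prop) fun _ => Or.inr (by linarith)
  unfold weight
  fun_prop

theorem continuous_weightDeriv {H : ℝ} (hH₁ : 1 / 2 < H) : Continuous (weightDeriv H) := by
  have h : Continuous fun v : ℝ => (1 - exp (-v)) ^ (2 * H) :=
    Continuous.rpow_const (by fun_prop) fun _ => Or.inr (by linarith)
  have h' : Continuous fun v : ℝ => (1 - exp (-v)) ^ (2 * H - 1) :=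
    Continuous.rpow_const (by fun_prop) fun _ => Or.inr (by linarith)
  unfold weightDeriv
  fun_prop

theorem integrableOn_weight {H : ℝ} (hH₁ : 1 / 2 < H) (hH₂ : H < 1) :
    IntegrableOn (weight H) (Set.Ioi 0) :=
  ((integrableOn_exp_neg_mul (sub_pos.2 hH₂)).const_mul 3).mono'
    (continuous_weight hH₁).aestronglyMeasurable
    ((ae_restrict_iff' measurableSet_Ioi).2 (.of_forall fun _ hv => abs_weight_le hH₁ hH₂ hv))

theorem integrableOn_slopePart {H : ℝ} (hH₁ : 1 / 2 < H) (hH₂ : H < 1) :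
    IntegrableOn (fun v => slopePart H (exp (-v))) (Set.Ioi 0) :=
  integrableOn_comp_exp_neg (slopePart_monotoneOn hH₁ hH₂) (sub_pos.2 hH₂)
    (fun _ => slopePart_nonneg hH₁) fun _ => slopePart_le hH₁

theorem integrableOn_discardedPart {H : ℝ} (hH₁ : 1 / 2 < H) (hH₂ : H < 1) :
    IntegrableOn (fun v => discardedPart H (exp (-v))) (Set.Ioi 0) :=
  integrableOn_comp_exp_neg (discardedPart_monotoneOn hH₁ hH₂) (sub_pos.2 hH₂)
    (fun _ => discardedPart_nonneg hH₁ hH₂) fun _ => discardedPart_le hH₁ hH₂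

theorem integrableOn_mul_sin_const_mul {f : ℝ → ℝ} {s : Set ℝ} (hi : IntegrableOn f s) (x : ℝ) :
    IntegrableOn (fun v => f v * sin (x * v)) s := by
  simpa using integrableOn_mul_sin hi x 0

theorem integrableOn_kernel {H : ℝ} (hH₁ : 1 / 2 < H) (hH₂ : H < 1) :
    IntegrableOn (kernel H) (Set.Ioi 0) :=
  ((((((integrableOn_exp_neg_mul (a := 3 * H) (by linarith)).const_mul _).add
    ((integrableOn_exp_neg_mul (a := 1 + H) (by linarith)).const_mul _)).sub
    ((integrableOn_exp_neg_mul (a := 2 + H) (by linarith)).const_mul _)).add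
    (integrableOn_slopePart hH₁ hH₂)).sub (integrableOn_discardedPart hH₁ hH₂))

theorem mul_integral_weight_mul_sin {H : ℝ} (hH₁ : 1 / 2 < H) (hH₂ : H < 1) (x : ℝ) :
    (H ^ 2 + x ^ 2) * ∫ v in Set.Ioi 0, weight H v * sin (x * v) =
      ∫ v in Set.Ioi 0, kernel H v * sin (x * v) := by
  have hw := integrableOn_mul_sin_const_mul (integrableOn_weight hH₁ hH₂) x
  have hk := integrableOn_mul_sin_const_mul (integrableOn_kernel hH₁ hH₂) x
  have hcont : Continuous fun v =>
      weightDeriv H v * sin (x * v) - x * (weight H v * cos (x * v)) := by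
    have := continuous_weight hH₁
    have := continuous_weightDeriv hH₁
    fun_prop
  have hder : ∀ v ∈ Set.Ioi (0 : ℝ), HasDerivAt
      (fun v => weightDeriv H v * sin (x * v) - x * (weight H v * cos (x * v)))
      ((H ^ 2 + x ^ 2) * (weight H v * sin (x * v)) - kernel H v * sin (x * v)) v := by
    intro v hv
    have h1 : HasDerivAt (fun v => sin (x * v)) (cos (x * v) * x) v := by
      simpa using ((hasDerivAt_id v).const_mul x).sin
    have h2 : HasDerivAt (fun v => cos (x * v)) (-sin (x * v) * x) v := by
      simpa using ((hasDerivAt_id v).const_mul x).cos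
    refine (((hasDerivAt_weightDeriv hv).mul h1).sub
      (((hasDerivAt_weight hv).mul h2).const_mul x)).congr_deriv ?_
    ring
  have hlim : Filter.Tendsto
      (fun v => weightDeriv H v * sin (x * v) - x * (weight H v * cos (x * v)))
      Filter.atTop (nhds 0) := by
    have h0 : Filter.Tendsto (fun v => (10 + |x| * 3) * exp (-((1 - H) * v)))
        Filter.atTop (nhds 0) := by
      simpa using (tendsto_exp_neg_atTop_nhds_zero.comp
        (Filter.tendsto_id.const_mul_atTop (sub_pos.2 hH₂))).const_mul (10 + |x| * 3)
    refine squeeze_zero_norm' ?_ h0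
    filter_upwards [Filter.eventually_gt_atTop 0] with v hv
    have h1 : |weightDeriv H v * sin (x * v)| ≤ 10 * exp (-((1 - H) * v)) := by
      rw [abs_mul]
      exact (mul_le_of_le_one_right (abs_nonneg _) (abs_sin_le_one _)).trans
        (abs_weightDeriv_le hH₁ hH₂ hv)
    have h2 : |x * (weight H v * cos (x * v))| ≤ |x| * (3 * exp (-((1 - H) * v))) := by
      rw [abs_mul, abs_mul (weight H v)]
      exact mul_le_mul_of_nonneg_left ((mul_le_of_le_one_right (abs_nonneg _)
        (abs_cos_le_one _)).trans (abs_weight_le hH₁ hH₂ hv)) (abs_nonneg _)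
    rw [norm_eq_abs]
    have h3 := abs_sub (weightDeriv H v * sin (x * v)) (x * (weight H v * cos (x * v)))
    linarith
  have h := integral_Ioi_of_hasDerivAt_of_tendsto hcont.continuousWithinAt hder
    ((hw.const_mul _).sub hk) hlim
  rw [integral_sub (hw.const_mul _) hk, integral_const_mul] at h
  have h0 : weight H 0 = 0 := by simp [weight]
  simp only [mul_zero, sin_zero, h0, zero_mul, sub_self] at h
  linarith

theorem integral_kernel_mul_sin {H : ℝ} (hH₁ : 1 / 2 < H) (hH₂ : H < 1) (x : ℝ) :
    ∫ v in Set.Ioi 0, kernel H v * sin (x * v) =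
      8 * H ^ 2 * (x / ((3 * H) ^ 2 + x ^ 2)) + 8 * H ^ 2 * (x / ((1 + H) ^ 2 + x ^ 2))
      - 8 * H ^ 2 * (2 * H - 1) * (x / ((2 + H) ^ 2 + x ^ 2))
      + (∫ v in Set.Ioi 0, slopePart H (exp (-v)) * sin (x * v))
      - ∫ v in Set.Ioi 0, discardedPart H (exp (-v)) * sin (x * v) := by
  have hexp : ∀ a : ℝ, 0 < a → ∀ c : ℝ,
      IntegrableOn (fun v => c * (exp (-(a * v)) * sin (x * v))) (Set.Ioi 0) := fun a ha c =>
    (integrableOn_mul_sin_const_mul (integrableOn_exp_neg_mul ha) x).const_mul c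
  have i1 := hexp (3 * H) (by linarith) (8 * H ^ 2)
  have i2 := hexp (1 + H) (by linarith) (8 * H ^ 2)
  have i3 := hexp (2 + H) (by linarith) (8 * H ^ 2 * (2 * H - 1))
  have i4 := integrableOn_mul_sin_const_mul (integrableOn_slopePart hH₁ hH₂) x
  have i5 := integrableOn_mul_sin_const_mul (integrableOn_discardedPart hH₁ hH₂) x
  rw [← integral_exp_mul_sin (a := 3 * H) (by linarith),
    ← integral_exp_mul_sin (a := 1 + H) (by linarith),
    ← integral_exp_mul_sin (a := 2 + H) (by linarith), ← integral_const_mul, ← integral_const_mul,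
    ← integral_const_mul, ← integral_add' i1 i2, ← integral_sub' (i1.add i2) i3,
    ← integral_add' ((i1.add i2).sub i3) i4, ← integral_sub' (((i1.add i2).sub i3).add i4) i5]
  congr 1
  ext v
  simp only [kernel, Pi.add_apply, Pi.sub_apply]
  ring

theorem integral_discardedPart_mul_sin_nonneg {H : ℝ} (hH₁ : 1 / 2 < H) (hH₂ : H < 1) {x : ℝ}
    (hx : 0 ≤ x) : 0 ≤ ∫ v in Set.Ioi 0, discardedPart H (exp (-v)) * sin (x * v) := by
  rcases hx.eq_or_lt with rfl | hx
  · simp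
  simpa using integral_Ioi_mul_sin_nonneg
    (antitoneOn_comp_exp_neg (discardedPart_monotoneOn hH₁ hH₂))
    (integrableOn_discardedPart hH₁ hH₂) hx le_rfl

theorem integral_slopePart_mul_sin_le_div {H : ℝ} (hH₁ : 1 / 2 < H) (hH₂ : H < 1) {x : ℝ}
    (hx : 0 < x) : ∫ v in Set.Ioi 0, slopePart H (exp (-v)) * sin (x * v) ≤
      2 * (4 * H ^ 2 * (2 * H - 1)) / x := by
  refine integral_Ioi_mul_sin_le (antitoneOn_comp_exp_neg (slopePart_monotoneOn hH₁ hH₂))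
    (integrableOn_slopePart hH₁ hH₂) (fun v hv => ?_) hx
  have hs := exp_neg_mem_Ioo hv
  exact (slopePart_le hH₁ hs).trans (mul_le_of_le_one_right
    (mul_nonneg (by positivity) (by linarith)) (rpow_le_one hs.1.le hs.2.le (by linarith)))

theorem integral_slopePart_mul_sin_le {H : ℝ} (hH₁ : 1 / 2 < H) (hH₂ : H < 1) (x : ℝ) :
    ∫ v in Set.Ioi 0, slopePart H (exp (-v)) * sin (x * v) ≤
      4 * H ^ 2 * (2 * H - 1) / (1 - H) := by
  have hval : ∫ v in Set.Ioi 0, 4 * H ^ 2 * (2 * H - 1) * exp (-((1 - H) * v)) =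
      4 * H ^ 2 * (2 * H - 1) / (1 - H) := by
    have := integral_exp_mul_Ioi (a := -(1 - H)) (by linarith) 0
    simp only [neg_mul, mul_zero, exp_zero, neg_div_neg_eq] at this
    rw [integral_const_mul, this, mul_one_div]
  rw [← hval]
  refine setIntegral_mono_on (integrableOn_mul_sin_const_mul (integrableOn_slopePart hH₁ hH₂) x)
    ((integrableOn_exp_neg_mul (sub_pos.2 hH₂)).const_mul _) measurableSet_Ioi fun v hv => ?_
  have hs := exp_neg_mem_Ioo hv
  rw [← exp_neg_rpow]
  exact (mul_le_of_le_one_right (slopePart_nonneg hH₁ hs) (sin_le_one _)).trans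
    (slopePart_le hH₁ hs)

theorem integral_kernel_mul_sin_le_div {H : ℝ} (hH₁ : 1 / 2 < H) (hH₂ : H < 1) {x : ℝ}
    (hx : 0 < x) : ∫ v in Set.Ioi 0, kernel H v * sin (x * v) ≤ 16 * H ^ 2 / x := by
  have h1 := integral_slopePart_mul_sin_le_div hH₁ hH₂ hx
  have h2 := integral_discardedPart_mul_sin_nonneg hH₁ hH₂ hx.le
  rw [integral_kernel_mul_sin hH₁ hH₂]
  have e : ∀ a : ℝ, 0 < a → x / (a ^ 2 + x ^ 2) = 1 / x - a ^ 2 / (a ^ 2 + x ^ 2) / x := by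
    intro a ha
    field_simp
    ring
  have hmono : ∀ a : ℝ, 0 < a → a ≤ 2 + H →
      a ^ 2 / ((2 + H) ^ 2 + x ^ 2) ≤ a ^ 2 / (a ^ 2 + x ^ 2) := by
    intro a ha hle
    gcongr
  have hb := hmono (1 + H) (by linarith) (by linarith)
  have hc := hmono (3 * H) (by linarith) (by linarith)
  have hpoly : (2 * H - 1) * (2 + H) ^ 2 ≤ (1 + H) ^ 2 + (3 * H) ^ 2 := by
    nlinarith [mul_pos (sub_pos.2 hH₁) (sub_pos.2 hH₂), sq_nonneg (H - 4 / 5)]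
  have hd : (2 * H - 1) * ((2 + H) ^ 2 / ((2 + H) ^ 2 + x ^ 2)) ≤
      (1 + H) ^ 2 / ((2 + H) ^ 2 + x ^ 2) + (3 * H) ^ 2 / ((2 + H) ^ 2 + x ^ 2) := by
    rw [← add_div, ← mul_div_assoc]
    gcongr
  have hkey : 0 ≤ 8 * H ^ 2 / x * ((1 + H) ^ 2 / ((1 + H) ^ 2 + x ^ 2)
      + (3 * H) ^ 2 / ((3 * H) ^ 2 + x ^ 2)
      - (2 * H - 1) * ((2 + H) ^ 2 / ((2 + H) ^ 2 + x ^ 2))) :=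
    mul_nonneg (by positivity) (by linarith)
  rw [e (3 * H) (by linarith), e (1 + H) (by linarith), e (2 + H) (by linarith)]
  refine le_of_sub_nonneg ((add_nonneg (add_nonneg hkey (sub_nonneg.2 h1)) h2).trans_eq ?_)
  ring

theorem div_sq_add_sq_le_inv {a x : ℝ} (ha : 0 < a) : x / (a ^ 2 + x ^ 2) ≤ 1 / (2 * a) := by
  rw [div_le_div_iff₀ (by positivity) (by positivity)]
  nlinarith [sq_nonneg (a - x)]

theorem integral_kernel_mul_sin_le {H : ℝ} (hH₁ : 1 / 2 < H) (hH₂ : H < 1) {x : ℝ}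
    (hx : 0 ≤ x) : ∫ v in Set.Ioi 0, kernel H v * sin (x * v) ≤ 4 * H / (1 - H) := by
  have hH : 0 < H := by linarith
  have h1 := integral_slopePart_mul_sin_le hH₁ hH₂ x
  have h2 := integral_discardedPart_mul_sin_nonneg hH₁ hH₂ hx
  have h3 : 8 * H ^ 2 * (x / ((3 * H) ^ 2 + x ^ 2)) ≤ 8 * H ^ 2 * (1 / (2 * (3 * H))) :=
    mul_le_mul_of_nonneg_left (div_sq_add_sq_le_inv (by linarith)) (by positivity)
  have h4 : 8 * H ^ 2 * (x / ((1 + H) ^ 2 + x ^ 2)) ≤ 8 * H ^ 2 * (1 / (2 * (1 + H))) :=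
    mul_le_mul_of_nonneg_left (div_sq_add_sq_le_inv (by linarith)) (by positivity)
  have h5 : 0 ≤ 8 * H ^ 2 * (2 * H - 1) * (x / ((2 + H) ^ 2 + x ^ 2)) :=
    mul_nonneg (mul_nonneg (by positivity) (by linarith)) (by positivity)
  have h6 : 8 * H ^ 2 * (1 / (2 * (3 * H))) = 4 / 3 * H := by field_simp; ring
  have h7 : 8 * H ^ 2 * (1 / (2 * (1 + H))) ≤ 4 * H := by
    rw [mul_one_div, div_le_iff₀ (by linarith)]
    nlinarith
  have h8 : 4 * H / (1 - H) - 4 * H ^ 2 * (2 * H - 1) / (1 - H) = 4 * H * (1 + 2 * H) := by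
    have : 1 - H ≠ 0 := by linarith
    field_simp
    ring
  rw [integral_kernel_mul_sin hH₁ hH₂]
  nlinarith

/-- Upper bounds on the sine transform `b(x)` of
`F_H(v)(1 − e^{−2Hv})` for `1/2 < H < 1`. -/
theorem sine_transform_upper_bounds (H : ℝ) (hH₁ : 1 / 2 < H) (hH₂ : H < 1)
    (b : ℝ → ℝ)
    (hb : ∀ x : ℝ, b x = ∫ v in Set.Ioi (0:ℝ),
      Ffun H v * (1 - Real.exp (-(2 * H * v))) * Real.sin (x * v)) :
    (∀ x : ℝ, H ≤ x → b x ≤ 16 * H ^ 2 / ((H ^ 2 + x ^ 2) * x))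
    ∧ (∀ x : ℝ, 0 ≤ x → x < H → b x ≤ 4 * H / ((1 - H) * (H ^ 2 + x ^ 2))) := by
  have hpos : ∀ x : ℝ, 0 < H ^ 2 + x ^ 2 := fun x => by
    have : 0 < H := by linarith
    positivity
  have hbx : ∀ x, (H ^ 2 + x ^ 2) * b x = ∫ v in Set.Ioi 0, kernel H v * sin (x * v) := by
    intro x
    rw [← mul_integral_weight_mul_sin hH₁ hH₂, hb]
    congr 1
    refine setIntegral_congr_fun measurableSet_Ioi fun v hv => ?_
    simp only [Ffun_mul_eq_weight hv]
  refine ⟨fun x hx => ?_, fun x hx _ => ?_⟩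
  · rw [mul_comm (H ^ 2 + x ^ 2), ← div_div, le_div_iff₀ (hpos x), mul_comm, hbx]
    exact integral_kernel_mul_sin_le_div hH₁ hH₂ (by linarith)
  · rw [← div_div, le_div_iff₀ (hpos x), mul_comm, hbx]
    exact integral_kernel_mul_sin_le hH₁ hH₂ hx
end
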